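/- arXiv:2605.10595 — 3 statements merged into one kernel-verified Lean document; each statement's English description precedes it below -/
import Mathlib

section
/- Let x₀ ∈ B_p ⊂ ℝ² (or ℝ^d) and let (x_t) be the exact-line-search Frank–Wolfe trajectory on B_p for f(x) = ‖x - e₁‖₂² started from x₀. For any θ ∈ (0, 1/2] and μ > 0, define g(x) = μ^{-1/θ}·‖x - e₁‖₂^{1/θ} = μ^{-1/θ}·f(x)^{1/(2θ)}. Then exact-line-search Frank–Wolfe on B_p applied to g from the same initialization x₀ produces exactly the same sequence of iterates (x_t): at every non-optimal iterate the argmin sets of the linear minimization oracle for ∇g and ∇f over B_p coincide, and the exact-line-search step sizes coincide. -/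
/-!
STATEMENT 14: Power transforms preserve exact-line-search Frank–Wolfe
trajectories: running Frank–Wolfe with exact line search on
g(x) = μ^{-1/θ}·‖x-e₁‖₂^{1/θ} over B_p from x₀ produces exactly the same
iterates as running it on f(x) = ‖x-e₁‖₂²; at non-optimal points the LMO
argmin sets for ∇g and ∇f coincide, and the exact-line-search step-size
argmin sets coincide.
-/

noncomputable section
open Real

namespace Stmt14

/-- Hölder conjugate q = p/(p-1). -/
def qc (p : ℝ) : ℝ := p / (p - 1)

/-- α = (p-1)/p = 1/q. -/
def alphac (p : ℝ) : ℝ := (p - 1) / p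

/-- M = (u^q + |w|^q)^{1/q}. -/
def Mv (p u w : ℝ) : ℝ := (u ^ qc p + |w| ^ qc p) ^ (1 / qc p)

/-- First coordinate of the LMO output: v₁ = u^{q-1}/M^{q-1}. -/
def v1f (p u w : ℝ) : ℝ := u ^ (qc p - 1) / Mv p u w ^ (qc p - 1)

/-- Second coordinate of the LMO output: v₂ = -sign(w)·|w|^{q-1}/M^{q-1}. -/
def v2f (p u w : ℝ) : ℝ := -(Real.sign w) * |w| ^ (qc p - 1) / Mv p u w ^ (qc p - 1)

/-- d₁ = v₁ - 1 + u. -/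
def d1f (p u w : ℝ) : ℝ := v1f p u w - 1 + u

/-- d₂ = v₂ - w. -/
def d2f (p u w : ℝ) : ℝ := v2f p u w - w

/-- Exact line-search step size γ = (M - u + u² + w²)/(d₁² + d₂²). -/
def gamf (p u w : ℝ) : ℝ :=
  (Mv p u w - u + u ^ 2 + w ^ 2) / (d1f p u w ^ 2 + d2f p u w ^ 2)

/-- u' = u - γ·d₁. -/
def uN (p u w : ℝ) : ℝ := u - gamf p u w * d1f p u w

/-- w' = w + γ·d₂. -/
def wN (p u w : ℝ) : ℝ := w + gamf p u w * d2f p u w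

/-- Scaled one-step map Φ(u,y) = |w'|/(u')^{1+α} where w = y·u^{1+α}. -/
def Phi (p u y : ℝ) : ℝ :=
  |wN p u (y * u ^ (1 + alphac p))| /
    (uN p u (y * u ^ (1 + alphac p))) ^ (1 + alphac p)

/-- C_p = (p/(p+1))^{1/q}. -/
def Cp (p : ℝ) : ℝ := (p / (p + 1)) ^ (1 / qc p)

/-- D_p = C_p·(p-1)(3p+1)/(2p(p+1)²). -/
def Dp (p : ℝ) : ℝ := Cp p * ((p - 1) * (3 * p + 1)) / (2 * p * (p + 1) ^ 2)

/-- Membership in the closed unit ℓ_p ball of ℝ². -/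
def inBp (p : ℝ) (z : ℝ × ℝ) : Prop := |z.1| ^ p + |z.2| ^ p ≤ 1

/-- The objective f(x) = ‖x - e₁‖₂² on ℝ². -/
def fobj (z : ℝ × ℝ) : ℝ := (z.1 - 1) ^ 2 + z.2 ^ 2

/-- The point a + s·(b - a). -/
def seg (a b : ℝ × ℝ) (s : ℝ) : ℝ × ℝ := (a.1 + s * (b.1 - a.1), a.2 + s * (b.2 - a.2))

/-- `IsFWTraj p x v γ`: (x,v,γ) is an exact-line-search Frank–Wolfe trajectory on B_p
for f(x) = ‖x - e₁‖₂² (whose gradient at z is (2(z₁-1), 2z₂)). -/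
def IsFWTraj (p : ℝ) (x v : ℕ → ℝ × ℝ) (γ : ℕ → ℝ) : Prop :=
  (∀ t, inBp p (v t) ∧ ∀ b : ℝ × ℝ, inBp p b →
      2 * ((x t).1 - 1) * (v t).1 + 2 * (x t).2 * (v t).2
        ≤ 2 * ((x t).1 - 1) * b.1 + 2 * (x t).2 * b.2) ∧
  (∀ t, γ t ∈ Set.Icc (0:ℝ) 1 ∧ ∀ s ∈ Set.Icc (0:ℝ) 1,
      fobj (seg (x t) (v t) (γ t)) ≤ fobj (seg (x t) (v t) s)) ∧
  (∀ t, x (t + 1) = seg (x t) (v t) (γ t))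

/-- The slow-start initialization x₀^slow(u₀) = (1-u₀, (C_p + D_p·u₀)·u₀^{1+α}). -/
def xslow (p u₀ : ℝ) : ℝ × ℝ := (1 - u₀, (Cp p + Dp p * u₀) * u₀ ^ (1 + alphac p))

/-- u_t = 1 - (x_t)₁. -/
def ucoord (x : ℕ → ℝ × ℝ) (t : ℕ) : ℝ := 1 - (x t).1

/-- y_t = |(x_t)₂| / u_t^{1+α}. -/
def ycoord (p : ℝ) (x : ℕ → ℝ × ℝ) (t : ℕ) : ℝ :=
  |(x t).2| / (ucoord x t) ^ (1 + alphac p)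

/-- Euclidean dot product on ℝ². -/
def dot (a b : ℝ × ℝ) : ℝ := a.1 * b.1 + a.2 * b.2

/-- The gradient of f: ∇f(z) = 2(z - e₁). -/
def fvec (z : ℝ × ℝ) : ℝ × ℝ := (2 * (z.1 - 1), 2 * z.2)

/-- g(x) = μ^{-1/θ}·‖x - e₁‖₂^{1/θ} = μ^{-1/θ}·f(x)^{1/(2θ)}. -/
def gobj (μ θ : ℝ) (z : ℝ × ℝ) : ℝ := μ ^ (-(1/θ)) * (fobj z) ^ (1 / (2 * θ))

/-- The gradient of g: ∇g(z) = μ^{-1/θ}·(1/θ)·f(z)^{1/(2θ)-1}·(z - e₁). -/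
def gvec (μ θ : ℝ) (z : ℝ × ℝ) : ℝ × ℝ :=
  (μ ^ (-(1/θ)) * (1/θ) * (fobj z) ^ (1 / (2 * θ) - 1) * (z.1 - 1),
   μ ^ (-(1/θ)) * (1/θ) * (fobj z) ^ (1 / (2 * θ) - 1) * z.2)

/-- `IsFWTrajGen p grad obj x v γ`: exact-line-search Frank–Wolfe trajectory on
B_p for an objective `obj` with gradient field `grad`. -/
def IsFWTrajGen (p : ℝ) (grad : ℝ × ℝ → ℝ × ℝ) (obj : ℝ × ℝ → ℝ)
    (x v : ℕ → ℝ × ℝ) (γ : ℕ → ℝ) : Prop :=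
  (∀ t, inBp p (v t) ∧ ∀ b : ℝ × ℝ, inBp p b →
      dot (grad (x t)) (v t) ≤ dot (grad (x t)) b) ∧
  (∀ t, γ t ∈ Set.Icc (0:ℝ) 1 ∧ ∀ s ∈ Set.Icc (0:ℝ) 1,
      obj (seg (x t) (v t) (γ t)) ≤ obj (seg (x t) (v t) s)) ∧
  (∀ t, x (t + 1) = seg (x t) (v t) (γ t))

theorem fobj_nonneg (z : ℝ × ℝ) : 0 ≤ fobj z := by
  unfold fobj
  positivity

theorem fobj_eq_zero_iff {z : ℝ × ℝ} : fobj z = 0 ↔ z = (1, 0) := by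
  unfold fobj
  rw [add_eq_zero_iff_of_nonneg (sq_nonneg _) (sq_nonneg _), sq_eq_zero_iff, sq_eq_zero_iff,
    sub_eq_zero, Prod.ext_iff]

theorem gobj_le_gobj_iff {μ θ : ℝ} (hμ : 0 < μ) (hθ : 0 < θ) (a b : ℝ × ℝ) :
    gobj μ θ a ≤ gobj μ θ b ↔ fobj a ≤ fobj b := by
  unfold gobj
  rw [mul_le_mul_iff_right₀ (rpow_pos_of_pos hμ _),
    rpow_le_rpow_iff (fobj_nonneg a) (fobj_nonneg b) (by positivity)]

theorem dot_gvec_le_iff {μ θ : ℝ} (hμ : 0 < μ) (hθ : 0 < θ) {z : ℝ × ℝ} (hz : z ≠ (1, 0))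
    (b c : ℝ × ℝ) :
    dot (gvec μ θ z) b ≤ dot (gvec μ θ z) c ↔ dot (fvec z) b ≤ dot (fvec z) c := by
  have hfz : 0 < fobj z := (fobj_nonneg z).lt_of_ne' (fobj_eq_zero_iff.not.mpr hz)
  have hk : 0 < μ ^ (-(1/θ)) * (1/θ) * (fobj z) ^ (1 / (2 * θ) - 1) / 2 := by positivity
  have hdot (b : ℝ × ℝ) : dot (gvec μ θ z) b =
      μ ^ (-(1/θ)) * (1/θ) * (fobj z) ^ (1 / (2 * θ) - 1) / 2 * dot (fvec z) b := by
    simp only [dot, gvec, fvec]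
    ring
  rw [hdot, hdot, mul_le_mul_iff_right₀ hk]

theorem abs_midpoint_rpow_lt {p : ℝ} (hp : 1 < p) {a b : ℝ} (hab : a ≠ b) :
    |(a + b) / 2| ^ p < (|a| ^ p + |b| ^ p) / 2 := by
  by_cases h : |a| = |b|
  · obtain rfl : a = -b := (abs_eq_abs.mp h).resolve_left hab
    have hb : b ≠ 0 := by
      rintro rfl
      simp at hab
    have : 0 < |b| ^ p := rpow_pos_of_pos (abs_pos.mpr hb) p
    simpa [zero_rpow (by linarith : p ≠ 0)] using this
  · have hconv := (strictConvexOn_rpow hp).2 (Set.mem_Ici.mpr (abs_nonneg a))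
      (Set.mem_Ici.mpr (abs_nonneg b)) h (by norm_num : (0:ℝ) < 1 / 2)
      (by norm_num : (0:ℝ) < 1 / 2) (by norm_num)
    simp only [smul_eq_mul] at hconv
    have htri : |(a + b) / 2| ≤ 1 / 2 * |a| + 1 / 2 * |b| := by
      rw [abs_div, abs_two]
      linarith [abs_add_le a b]
    have := rpow_le_rpow (abs_nonneg _) htri (by linarith : 0 ≤ p)
    linarith

theorem abs_midpoint_rpow_le {p : ℝ} (hp : 1 < p) (a b : ℝ) :
    |(a + b) / 2| ^ p ≤ (|a| ^ p + |b| ^ p) / 2 := by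
  rcases eq_or_ne a b with rfl | hab
  · simp
  · exact (abs_midpoint_rpow_lt hp hab).le

/-- The midpoint of two distinct points of `B_p` satisfies the defining inequality strictly. -/
theorem midpoint_mem_interior {p : ℝ} (hp : 1 < p) {v w : ℝ × ℝ} (hv : inBp p v)
    (hw : inBp p w) (hvw : v ≠ w) :
    |(v.1 + w.1) / 2| ^ p + |(v.2 + w.2) / 2| ^ p < 1 := by
  unfold inBp at hv hw
  by_cases h : v.1 = w.1
  · have h2 : v.2 ≠ w.2 := fun h2 => hvw (Prod.ext h h2)
    linarith [abs_midpoint_rpow_le hp v.1 w.1, abs_midpoint_rpow_lt hp h2]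
  · linarith [abs_midpoint_rpow_lt hp h, abs_midpoint_rpow_le hp v.2 w.2]

/-- A nonzero linear functional has no minimizer over `B_p` in the interior. -/
theorem exists_inBp_dot_lt {p : ℝ} (hp : 1 < p) {c m : ℝ × ℝ} (hc : c ≠ 0)
    (hm : |m.1| ^ p + |m.2| ^ p < 1) : ∃ b, inBp p b ∧ dot c b < dot c m := by
  have hcont : Continuous fun s : ℝ => |m.1 - s * c.1| ^ p + |m.2 - s * c.2| ^ p := by
    have hp0 : 0 ≤ p := by linarith
    exact ((by fun_prop : Continuous fun s : ℝ => |m.1 - s * c.1|).rpow_const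
      fun _ => Or.inr hp0).add
      ((by fun_prop : Continuous fun s : ℝ => |m.2 - s * c.2|).rpow_const fun _ => Or.inr hp0)
  have hev : ∀ᶠ s in nhds (0:ℝ), |m.1 - s * c.1| ^ p + |m.2 - s * c.2| ^ p < 1 :=
    hcont.continuousAt.eventually_lt_const (by simpa using hm)
  obtain ⟨s, hs, hs0⟩ :=
    ((hev.filter_mono nhdsWithin_le_nhds).and (self_mem_nhdsWithin (s := Set.Ioi (0:ℝ)))).exists
  refine ⟨(m.1 - s * c.1, m.2 - s * c.2), hs.le, ?_⟩
  have hcpos : 0 < c.1 ^ 2 + c.2 ^ 2 := by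
    by_contra! h
    exact hc (Prod.ext (by simpa using (by nlinarith [sq_nonneg c.1, sq_nonneg c.2] : c.1 ^ 2 = 0))
      (by simpa using (by nlinarith [sq_nonneg c.1, sq_nonneg c.2] : c.2 ^ 2 = 0)))
  have := mul_pos (Set.mem_Ioi.mp hs0) hcpos
  simp only [dot]
  linarith

/-- The linear minimization oracle over `B_p` is single-valued for nonzero functionals. -/
theorem lmo_unique {p : ℝ} (hp : 1 < p) {c v w : ℝ × ℝ} (hc : c ≠ 0)
    (hv : inBp p v) (hvmin : ∀ b, inBp p b → dot c v ≤ dot c b)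
    (hw : inBp p w) (hwmin : ∀ b, inBp p b → dot c w ≤ dot c b) : v = w := by
  by_contra hvw
  obtain ⟨b, hb, hlt⟩ := exists_inBp_dot_lt (m := ((v.1 + w.1) / 2, (v.2 + w.2) / 2)) hp hc
    (midpoint_mem_interior hp hv hw hvw)
  have h1 := hvmin b hb
  have h2 := hwmin b hb
  simp only [dot] at hlt h1 h2
  linarith

/-- The point selected by exact line search for `fobj` is unique. -/
theorem seg_unique {a b : ℝ × ℝ} {s r : ℝ} (hs : s ∈ Set.Icc (0:ℝ) 1) (hr : r ∈ Set.Icc (0:ℝ) 1)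
    (hsmin : ∀ t ∈ Set.Icc (0:ℝ) 1, fobj (seg a b s) ≤ fobj (seg a b t))
    (hrmin : ∀ t ∈ Set.Icc (0:ℝ) 1, fobj (seg a b r) ≤ fobj (seg a b t)) :
    seg a b s = seg a b r := by
  have hmid : (s + r) / 2 ∈ Set.Icc (0:ℝ) 1 :=
    ⟨by linarith [hs.1, hr.1], by linarith [hs.2, hr.2]⟩
  have h1 := hsmin _ hmid
  have h2 := hrmin _ hmid
  have hpar : fobj (seg a b ((s + r) / 2)) = (fobj (seg a b s) + fobj (seg a b r)) / 2 -
      (((seg a b s).1 - (seg a b r).1) ^ 2 + ((seg a b s).2 - (seg a b r).2) ^ 2) / 4 := by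
    simp only [fobj, seg]
    ring
  have hsq1 := sq_nonneg ((seg a b s).1 - (seg a b r).1)
  have hsq2 := sq_nonneg ((seg a b s).2 - (seg a b r).2)
  exact Prod.ext (sub_eq_zero.mp (sq_eq_zero_iff.mp (by linarith)))
    (sub_eq_zero.mp (sq_eq_zero_iff.mp (by linarith)))

/-- Exact line search started at the optimum stays there. -/
theorem seg_eq_of_optimal {b : ℝ × ℝ} {s : ℝ}
    (hsmin : ∀ t ∈ Set.Icc (0:ℝ) 1, fobj (seg (1, 0) b s) ≤ fobj (seg (1, 0) b t)) :
    seg (1, 0) b s = (1, 0) := by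
  have h := hsmin 0 ⟨le_rfl, zero_le_one⟩
  have h0 : fobj (seg (1, 0) b 0) = 0 := by simp [fobj, seg]
  exact fobj_eq_zero_iff.mp (le_antisymm (h.trans_eq h0) (fobj_nonneg _))

theorem fvec_ne_zero {z : ℝ × ℝ} (hz : z ≠ (1, 0)) : fvec z ≠ 0 := by
  intro h
  rw [fvec, Prod.ext_iff] at h
  simp only [Prod.fst_zero, Prod.snd_zero] at h
  exact hz (Prod.ext (by linarith [h.1]) (by linarith [h.2]))

theorem same_trajectory (p : ℝ) (hp : 1 < p) (μ θ : ℝ) (hμ : 0 < μ)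
    (hθ : θ ∈ Set.Ioc (0:ℝ) (1/2))
    (x v x' v' : ℕ → ℝ × ℝ) (γ γ' : ℕ → ℝ)
    (hx0feas : inBp p (x 0))
    (hf : IsFWTrajGen p fvec fobj x v γ)
    (hg : IsFWTrajGen p (gvec μ θ) (gobj μ θ) x' v' γ')
    (h00 : x' 0 = x 0) :
    -- the iterates coincide
    (∀ t, x' t = x t) ∧
    -- at every non-optimal point the LMO argmin sets for ∇g and ∇f coincide
    (∀ z : ℝ × ℝ, z ≠ ((1:ℝ), (0:ℝ)) →
      {b : ℝ × ℝ | inBp p b ∧ ∀ c : ℝ × ℝ, inBp p c →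
          dot (gvec μ θ z) b ≤ dot (gvec μ θ z) c}
        = {b : ℝ × ℝ | inBp p b ∧ ∀ c : ℝ × ℝ, inBp p c →
            dot (fvec z) b ≤ dot (fvec z) c}) ∧
    -- the exact-line-search step-size argmin sets coincide
    (∀ z b : ℝ × ℝ,
      {s : ℝ | s ∈ Set.Icc (0:ℝ) 1 ∧ ∀ s' ∈ Set.Icc (0:ℝ) 1,
          gobj μ θ (seg z b s) ≤ gobj μ θ (seg z b s')}
        = {s : ℝ | s ∈ Set.Icc (0:ℝ) 1 ∧ ∀ s' ∈ Set.Icc (0:ℝ) 1,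
            fobj (seg z b s) ≤ fobj (seg z b s')}) := by
  have hθ0 : 0 < θ := hθ.1
  refine ⟨fun t => ?_, fun z hz => ?_, fun z b => ?_⟩
  · induction t with
    | zero => exact h00
    | succ t ih =>
      obtain ⟨hlmo, hls, hstep⟩ := hf
      obtain ⟨hlmo', hls', hstep'⟩ := hg
      simp only [gobj_le_gobj_iff hμ hθ0] at hls'
      have hfs := hls t
      have hgs := hls' t
      have hfv := hlmo t
      have hgv := hlmo' t
      rw [ih] at hgs hgv
      rw [hstep, hstep', ih]
      by_cases hopt : x t = (1, 0)
      · rw [hopt] at hfs hgs ⊢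
        rw [seg_eq_of_optimal hfs.2, seg_eq_of_optimal hgs.2]
      · simp only [dot_gvec_le_iff hμ hθ0 hopt] at hgv
        have hv : v' t = v t :=
          lmo_unique hp (fvec_ne_zero hopt) hgv.1 hgv.2 hfv.1 hfv.2
        rw [hv] at hgs ⊢
        exact seg_unique hgs.1 hfs.1 hgs.2 hfs.2
  · simp only [dot_gvec_le_iff hμ hθ0 hz]
  · simp only [gobj_le_gobj_iff hμ hθ0]

end Stmt14
end
end

section
/- For every p ≥ 3, μ > 0, and θ ∈ (0, 1/2], consider B_p ⊂ ℝ² and g(x) = μ^{-1/θ}·‖x - e₁‖₂^{1/θ}, which is smooth on B_p and satisfies the (μ,θ)-Hölderian error bound with minimizer x* = e₁. For all sufficiently small u₀ > 0, the exact-line-search Frank–Wolfe iterates (x_t) for g started from the slow-start initialization x₀^slow(u₀) satisfy g(x_T) - g(x*) ~ μ^{-1/θ}·((p+1)/p)^{1/θ}·(p/(4(p-1)))^{p/(2θ(p-1))}·T^{-p/(2θ(p-1))} as T → ∞; in particular g(x_T) - g(x*) = Ω(T^{-p/(2θ(p-1))}). -/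
/-!
STATEMENT 15: HEB lower bound. For p ≥ 3, μ > 0, θ ∈ (0,1/2], the objective
g(x) = μ^{-1/θ}·‖x-e₁‖₂^{1/θ} on B_p ⊂ ℝ² is smooth (has a Lipschitz gradient
on B_p) and satisfies the (μ,θ)-Hölderian error bound with minimizer x* = e₁,
and for all sufficiently small u₀ > 0 the exact-line-search Frank–Wolfe iterates
for g from the slow-start initialization satisfy
g(x_T) - g(x*) ~ μ^{-1/θ}·((p+1)/p)^{1/θ}·(p/(4(p-1)))^{p/(2θ(p-1))}·T^{-p/(2θ(p-1))};
in particular g(x_T) - g(x*) = Ω(T^{-p/(2θ(p-1))}).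
-/

noncomputable section
open Real

namespace Stmt15

/-- Hölder conjugate q = p/(p-1). -/
def qc (p : ℝ) : ℝ := p / (p - 1)

/-- α = (p-1)/p = 1/q. -/
def alphac (p : ℝ) : ℝ := (p - 1) / p

/-- M = (u^q + |w|^q)^{1/q}. -/
def Mv (p u w : ℝ) : ℝ := (u ^ qc p + |w| ^ qc p) ^ (1 / qc p)

/-- First coordinate of the LMO output: v₁ = u^{q-1}/M^{q-1}. -/
def v1f (p u w : ℝ) : ℝ := u ^ (qc p - 1) / Mv p u w ^ (qc p - 1)

/-- Second coordinate of the LMO output: v₂ = -sign(w)·|w|^{q-1}/M^{q-1}. -/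
def v2f (p u w : ℝ) : ℝ := -(Real.sign w) * |w| ^ (qc p - 1) / Mv p u w ^ (qc p - 1)

/-- d₁ = v₁ - 1 + u. -/
def d1f (p u w : ℝ) : ℝ := v1f p u w - 1 + u

/-- d₂ = v₂ - w. -/
def d2f (p u w : ℝ) : ℝ := v2f p u w - w

/-- Exact line-search step size γ = (M - u + u² + w²)/(d₁² + d₂²). -/
def gamf (p u w : ℝ) : ℝ :=
  (Mv p u w - u + u ^ 2 + w ^ 2) / (d1f p u w ^ 2 + d2f p u w ^ 2)

/-- u' = u - γ·d₁. -/
def uN (p u w : ℝ) : ℝ := u - gamf p u w * d1f p u w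

/-- w' = w + γ·d₂. -/
def wN (p u w : ℝ) : ℝ := w + gamf p u w * d2f p u w

/-- Scaled one-step map Φ(u,y) = |w'|/(u')^{1+α} where w = y·u^{1+α}. -/
def Phi (p u y : ℝ) : ℝ :=
  |wN p u (y * u ^ (1 + alphac p))| /
    (uN p u (y * u ^ (1 + alphac p))) ^ (1 + alphac p)

/-- C_p = (p/(p+1))^{1/q}. -/
def Cp (p : ℝ) : ℝ := (p / (p + 1)) ^ (1 / qc p)

/-- D_p = C_p·(p-1)(3p+1)/(2p(p+1)²). -/
def Dp (p : ℝ) : ℝ := Cp p * ((p - 1) * (3 * p + 1)) / (2 * p * (p + 1) ^ 2)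

/-- Membership in the closed unit ℓ_p ball of ℝ². -/
def inBp (p : ℝ) (z : ℝ × ℝ) : Prop := |z.1| ^ p + |z.2| ^ p ≤ 1

/-- The objective f(x) = ‖x - e₁‖₂² on ℝ². -/
def fobj (z : ℝ × ℝ) : ℝ := (z.1 - 1) ^ 2 + z.2 ^ 2

/-- The point a + s·(b - a). -/
def seg (a b : ℝ × ℝ) (s : ℝ) : ℝ × ℝ := (a.1 + s * (b.1 - a.1), a.2 + s * (b.2 - a.2))

/-- `IsFWTraj p x v γ`: (x,v,γ) is an exact-line-search Frank–Wolfe trajectory on B_p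
for f(x) = ‖x - e₁‖₂² (whose gradient at z is (2(z₁-1), 2z₂)). -/
def IsFWTraj (p : ℝ) (x v : ℕ → ℝ × ℝ) (γ : ℕ → ℝ) : Prop :=
  (∀ t, inBp p (v t) ∧ ∀ b : ℝ × ℝ, inBp p b →
      2 * ((x t).1 - 1) * (v t).1 + 2 * (x t).2 * (v t).2
        ≤ 2 * ((x t).1 - 1) * b.1 + 2 * (x t).2 * b.2) ∧
  (∀ t, γ t ∈ Set.Icc (0:ℝ) 1 ∧ ∀ s ∈ Set.Icc (0:ℝ) 1,
      fobj (seg (x t) (v t) (γ t)) ≤ fobj (seg (x t) (v t) s)) ∧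
  (∀ t, x (t + 1) = seg (x t) (v t) (γ t))

/-- The slow-start initialization x₀^slow(u₀) = (1-u₀, (C_p + D_p·u₀)·u₀^{1+α}). -/
def xslow (p u₀ : ℝ) : ℝ × ℝ := (1 - u₀, (Cp p + Dp p * u₀) * u₀ ^ (1 + alphac p))

/-- u_t = 1 - (x_t)₁. -/
def ucoord (x : ℕ → ℝ × ℝ) (t : ℕ) : ℝ := 1 - (x t).1

/-- y_t = |(x_t)₂| / u_t^{1+α}. -/
def ycoord (p : ℝ) (x : ℕ → ℝ × ℝ) (t : ℕ) : ℝ :=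
  |(x t).2| / (ucoord x t) ^ (1 + alphac p)

/-- Euclidean dot product on ℝ². -/
def dot (a b : ℝ × ℝ) : ℝ := a.1 * b.1 + a.2 * b.2

/-- g(x) = μ^{-1/θ}·‖x - e₁‖₂^{1/θ} = μ^{-1/θ}·f(x)^{1/(2θ)}. -/
def gobj (μ θ : ℝ) (z : ℝ × ℝ) : ℝ := μ ^ (-(1/θ)) * (fobj z) ^ (1 / (2 * θ))

/-- The gradient of g: ∇g(z) = μ^{-1/θ}·(1/θ)·f(z)^{1/(2θ)-1}·(z - e₁). -/
def gvec (μ θ : ℝ) (z : ℝ × ℝ) : ℝ × ℝ :=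
  (μ ^ (-(1/θ)) * (1/θ) * (fobj z) ^ (1 / (2 * θ) - 1) * (z.1 - 1),
   μ ^ (-(1/θ)) * (1/θ) * (fobj z) ^ (1 / (2 * θ) - 1) * z.2)

/-- Exact-line-search Frank–Wolfe trajectory on B_p for objective `obj` with
gradient field `grad`. -/
def IsFWTrajGen (p : ℝ) (grad : ℝ × ℝ → ℝ × ℝ) (obj : ℝ × ℝ → ℝ)
    (x v : ℕ → ℝ × ℝ) (γ : ℕ → ℝ) : Prop :=
  (∀ t, inBp p (v t) ∧ ∀ b : ℝ × ℝ, inBp p b →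
      dot (grad (x t)) (v t) ≤ dot (grad (x t)) b) ∧
  (∀ t, γ t ∈ Set.Icc (0:ℝ) 1 ∧ ∀ s ∈ Set.Icc (0:ℝ) 1,
      obj (seg (x t) (v t) (γ t)) ≤ obj (seg (x t) (v t) s)) ∧
  (∀ t, x (t + 1) = seg (x t) (v t) (γ t))

open Asymptotics Filter Topology

section BigO

variable {ι : Type*} {l : Filter ι} {h : ι → ℝ}

lemma isBigO_pow_of_le (hh : Tendsto h l (𝓝 0)) {f : ι → ℝ} {m n : ℕ}
    (hf : f =O[l] fun i => h i ^ n) (hmn : m ≤ n) : f =O[l] fun i => h i ^ m := by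
  refine hf.trans (IsBigO.of_bound 1 ?_)
  filter_upwards [hh.norm.eventually_le_const (show ‖(0 : ℝ)‖ < 1 by simp)] with i hi
  rw [norm_pow, norm_pow, one_mul]
  exact pow_le_pow_of_le_one (norm_nonneg _) hi hmn

lemma isBigO_mul_pow {f g : ι → ℝ} {m n : ℕ} (hf : f =O[l] fun i => h i ^ m)
    (hg : g =O[l] fun i => h i ^ n) : (fun i => f i * g i) =O[l] fun i => h i ^ (m + n) := by
  simpa only [pow_add] using hf.mul hg

lemma isBigO_const_mul_pow {f : ι → ℝ} {m : ℕ} (c : ℝ) (hf : f =O[l] fun i => h i ^ m) :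
    (fun i => c * f i) =O[l] fun i => h i ^ m :=
  hf.const_mul_left c

lemma tendsto_zero_of_isBigO_pow (hh : Tendsto h l (𝓝 0)) {f : ι → ℝ} {m : ℕ} (hm : m ≠ 0)
    (hf : f =O[l] fun i => h i ^ m) : Tendsto f l (𝓝 0) := by
  refine hf.trans_tendsto ?_
  simpa [hm] using hh.pow m

lemma isBigO_div_pow {f D : ι → ℝ} {m k n : ℕ} (hmn : m = k + n) (h0 : ∀ᶠ i in l, 0 < h i)
    (hf : f =O[l] fun i => h i ^ m) {c : ℝ} (hc : 0 < c) (hD : ∀ᶠ i in l, c * h i ^ k ≤ D i) :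
    (fun i => f i / D i) =O[l] fun i => h i ^ n := by
  obtain ⟨C, hC⟩ := hf.bound
  refine IsBigO.of_bound (C / c) ?_
  filter_upwards [hC, hD, h0] with i h1 h2 h3
  have h4 : 0 < D i := lt_of_lt_of_le (by positivity) h2
  rw [norm_div, Real.norm_of_nonneg h4.le, div_le_iff₀ h4]
  have h5 : ‖h i ^ m‖ = h i ^ k * h i ^ n := by
    rw [Real.norm_of_nonneg (by positivity), hmn, pow_add]
  have h6 : ‖h i ^ n‖ = h i ^ n := Real.norm_of_nonneg (by positivity)
  rw [h5] at h1
  rw [h6]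
  have hC0 : 0 ≤ C := by
    have : 0 ≤ C * (h i ^ k * h i ^ n) := (norm_nonneg _).trans h1
    exact nonneg_of_mul_nonneg_left this (by positivity)
  calc ‖f i‖ ≤ C / c * h i ^ n * (c * h i ^ k) := h1.trans (le_of_eq (by field_simp))
    _ ≤ _ := by gcongr

end BigO

section Taylor

lemma one_add_rpow_isBigO_sq (c : ℝ) :
    (fun x : ℝ => (1 + x) ^ c - (1 + c * x)) =O[𝓝 0] (fun x => x ^ 2) := by
  have h := (Real.one_add_rpow_hasFPowerSeriesAt_zero (a := c)).isBigO_sub_partialSum_pow 2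
  simp only [zero_add, FormalMultilinearSeries.partialSum, Finset.sum_range_succ,
    Finset.sum_range_zero, binomialSeries_apply, ← norm_pow, isBigO_norm_right] at h
  simpa [mul_comm] using h

lemma choose_two_eq (c : ℝ) : Ring.choose c 2 = c * (c - 1) / 2 := by
  have h := Ring.descPochhammer_eq_factorial_smul_choose c 2
  simp [descPochhammer, Polynomial.smeval_mul, Polynomial.smeval_sub,
    Polynomial.smeval_X, Polynomial.smeval_one] at h
  linarith

lemma one_add_rpow_isBigO_cube (c : ℝ) :
    (fun x : ℝ => (1 + x) ^ c - (1 + c * x + c * (c - 1) / 2 * x ^ 2)) =O[𝓝 0]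
      (fun x => x ^ 3) := by
  have h := (Real.one_add_rpow_hasFPowerSeriesAt_zero (a := c)).isBigO_sub_partialSum_pow 3
  simp only [zero_add, FormalMultilinearSeries.partialSum, Finset.sum_range_succ,
    Finset.sum_range_zero, binomialSeries_apply, choose_two_eq, ← norm_pow,
    isBigO_norm_right] at h
  simpa [mul_comm, pow_two] using h

end Taylor

section Recurrence

/-- The quantity `u (1 - R R')` preserved by the line search, where `r = R ^ q` and
`R' = R (1 + δ)`. -/
def slowN (p r δ : ℝ) : ℝ := 1 - (1 - r * (1 + δ)) * (1 + r) ^ (-(1 / p))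

/-- The `q`-th power of the next slope. -/
def nextR (p r δ : ℝ) : ℝ := r * (1 + δ) ^ qc p

/-- The square of the slope `r ^ (1 / q)`. -/
def slopeSq (p r : ℝ) : ℝ := r ^ (2 * alphac p)

/-- The denominator in the formula for the next relative change of slope. -/
def nextDen (p r δ ρ : ℝ) : ℝ :=
  nextR p r δ * (1 + nextR p r δ) ^ (-(1 / p)) + slowN p r δ * (ρ / (1 + ρ))

/-- The next relative change of slope, where `ρ` is the next squared slope. -/
def nextDelta (p r δ ρ : ℝ) : ℝ :=
  (slowN p r δ * ((1 - ρ) / (1 + ρ)) - slowN p (nextR p r δ) 0) / nextDen p r δ ρ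

lemma slowN_eq {p r : ℝ} (hr : 0 < r) (δ : ℝ) :
    (1 + r) ^ (1 / p) * slowN p r δ = (1 + r) ^ (1 / p) - 1 + r * (1 + δ) := by
  have h : (1 + r) ^ (1 / p) * (1 + r) ^ (-(1 / p)) = 1 := by
    rw [← Real.rpow_add (by linarith)]; simp
  unfold slowN
  linear_combination (-(1 - r * (1 + δ))) * h

lemma one_add_nextR_rpow {p r δ : ℝ} (hr : 0 < r)
    (hx : 0 < 1 + (nextR p r δ - r) / (1 + r)) :
    (1 + r) ^ (1 / p) * (1 + nextR p r δ) ^ (-(1 / p)) =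
      (1 + (nextR p r δ - r) / (1 + r)) ^ (-(1 / p)) := by
  have h : (1 + r) ^ (1 / p) * (1 + r) ^ (-(1 / p)) = 1 := by
    rw [← Real.rpow_add (by linarith)]; simp
  have h1 : 1 + nextR p r δ = (1 + r) * (1 + (nextR p r δ - r) / (1 + r)) := by
    field_simp; ring
  rw [h1, Real.mul_rpow (by linarith) hx.le, ← mul_assoc, h, one_mul]

variable {ι : Type*} {l : Filter ι} {h ε ρ : ι → ℝ} {p : ℝ}

lemma nextDelta_isBigO (hp : 3 ≤ p) (hh : Tendsto h l (𝓝 0)) (h0 : ∀ᶠ i in l, 0 < h i)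
    (hε : ε =O[l] fun i => h i ^ 7) (hρ : ρ =O[l] fun i => h i ^ 8)
    {r δ ρ' : ι → ℝ} (hr : ∀ i, r i = h i ^ 6) (hδε : ∀ i, δ i = ε i - 2 * alphac p * ρ i)
    (hρ' : ∀ i, ρ' i = ρ i * (1 + δ i) ^ 2) :
    (fun i => nextDelta p (r i) (δ i) (ρ' i) + 2 * alphac p * ρ' i
      + 2 / ((p - 1) * (1 + r i)) * ε i) =O[l] fun i => h i ^ 14 := by
  have mono := fun {f : ι → ℝ} {m n : ℕ} => isBigO_pow_of_le (f := f) (m := m) (n := n) hh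
  have hr6 : r =O[l] fun i => h i ^ 6 := (isBigO_refl _ l).congr_left fun i => (hr i).symm
  have hδ : δ =O[l] fun i => h i ^ 7 :=
    (hε.sub (isBigO_const_mul_pow (2 * alphac p) (mono hρ (by norm_num : 7 ≤ 8)))).congr_left
      fun i => (hδε i).symm
  have hδ0 : Tendsto δ l (𝓝 0) := tendsto_zero_of_isBigO_pow hh (by norm_num) hδ
  have hr0 : Tendsto r l (𝓝 0) := tendsto_zero_of_isBigO_pow hh (by norm_num) hr6
  have one : ∀ {f : ι → ℝ} {c : ℝ}, Tendsto f l (𝓝 c) → f =O[l] fun i => h i ^ 0 := by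
    intro f c hf
    simpa using hf.isBigO_one ℝ
  -- the next value of `r`
  let e₁ : ι → ℝ := fun i => (1 + δ i) ^ qc p - (1 + qc p * δ i)
  have he₁ : e₁ =O[l] fun i => h i ^ 14 := by
    have := ((one_add_rpow_isBigO_sq (qc p)).comp_tendsto hδ0).trans (hδ.pow 2)
    exact this.congr_right fun i => (pow_mul _ _ _).symm
  let Δ : ι → ℝ := fun i => nextR p (r i) (δ i) - r i
  have hΔe : ∀ i, Δ i = r i * (qc p * δ i + e₁ i) := by
    intro i; simp only [Δ, e₁, nextR]; ring
  have hΔ : Δ =O[l] fun i => h i ^ 13 :=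
    (isBigO_mul_pow hr6 ((isBigO_const_mul_pow (qc p) hδ).add
      (mono he₁ (by norm_num : 7 ≤ 14)))).congr_left fun i => (hΔe i).symm
  have hinv : Tendsto (fun i => (1 + r i)⁻¹) l (𝓝 1) := by
    simpa using (hr0.const_add 1).inv₀ (by norm_num)
  let x : ι → ℝ := fun i => Δ i / (1 + r i)
  have hx : x =O[l] fun i => h i ^ 13 := by
    simpa only [x, div_eq_mul_inv, add_zero] using isBigO_mul_pow hΔ (one hinv)
  have hx0 : Tendsto x l (𝓝 0) := tendsto_zero_of_isBigO_pow hh (by norm_num) hx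
  let P : ι → ℝ := fun i => (1 + x i) ^ (-(1 / p))
  let e₂ : ι → ℝ := fun i => P i - (1 + -(1 / p) * x i)
  have he₂ : e₂ =O[l] fun i => h i ^ 26 := by
    have := ((one_add_rpow_isBigO_sq (-(1 / p))).comp_tendsto hx0).trans (hx.pow 2)
    exact this.congr_right fun i => (pow_mul _ _ _).symm
  let L : ι → ℝ := fun i => (1 + r i) ^ (1 / p)
  let e₃ : ι → ℝ := fun i => L i - (1 + 1 / p * r i)
  have he₃ : e₃ =O[l] fun i => h i ^ 12 := by
    have := ((one_add_rpow_isBigO_sq (1 / p)).comp_tendsto hr0).trans (hr6.pow 2)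
    exact this.congr_right fun i => (pow_mul _ _ _).symm
  -- squared slopes
  have hρ0 : Tendsto ρ l (𝓝 0) := tendsto_zero_of_isBigO_pow hh (by norm_num) hρ
  have hρ'8 : ρ' =O[l] fun i => h i ^ 8 :=
    (isBigO_mul_pow hρ (one ((hδ0.const_add 1).pow 2))).congr_left fun i => (hρ' i).symm
  have hρ'0 : Tendsto ρ' l (𝓝 0) := tendsto_zero_of_isBigO_pow hh (by norm_num) hρ'8
  have hρinv : Tendsto (fun i => (1 + ρ' i)⁻¹) l (𝓝 1) := by
    simpa using (hρ'0.const_add 1).inv₀ (by norm_num)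
  have hρq : (fun i => ρ' i * (1 + ρ' i)⁻¹) =O[l] fun i => h i ^ 8 :=
    isBigO_mul_pow hρ'8 (one hρinv)
  have hρd : (fun i => ρ' i - ρ i) =O[l] fun i => h i ^ 15 := by
    refine (isBigO_mul_pow hρ (isBigO_mul_pow hδ (one (hδ0.const_add 2)))).congr_left fun i => ?_
    rw [hρ']; ring
  have hρ1 : ∀ᶠ i in l, 0 < 1 + ρ' i := by
    have := hρ'0.const_add 1
    exact this.eventually_const_lt (by norm_num)
  have hρqd : (fun i => ρ' i * (1 + ρ' i)⁻¹ - ρ i) =O[l] fun i => h i ^ 15 := by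
    refine (hρd.sub (mono (isBigO_mul_pow hρ'8 hρq) (by norm_num : 15 ≤ 8 + 8))).congr' ?_
      EventuallyEq.rfl
    filter_upwards [hρ1] with i hi
    field_simp; ring
  -- numerator and denominator, multiplied by `L`
  let LN : ι → ℝ := fun i => L i - 1 + r i * (1 + δ i)
  have hLN : (fun i => LN i - (1 + 1 / p) * r i) =O[l] fun i => h i ^ 12 := by
    refine (he₃.add (mono (isBigO_mul_pow hr6 hδ) (by norm_num : 12 ≤ 6 + 7))).congr_left
      fun i => ?_
    simp only [LN, e₃]; ring
  let Num : ι → ℝ := fun i => LN i * ((1 - ρ' i) / (1 + ρ' i)) - (L i - (1 - (r i + Δ i)) * P i)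
  let Den : ι → ℝ := fun i => (r i + Δ i) * P i + LN i * (ρ' i / (1 + ρ' i))
  have hLN6 : LN =O[l] fun i => h i ^ 6 :=
    ((mono hLN (by norm_num : 6 ≤ 12)).add (isBigO_const_mul_pow (1 + 1 / p) hr6)).congr_left
      fun i => by ring
  have hP0 : Tendsto P l (𝓝 1) := by
    have h1 : Tendsto (fun i => 1 + x i) l (𝓝 1) := by simpa using hx0.const_add 1
    simpa [P] using h1.rpow_const (p := -(1 / p)) (Or.inl one_ne_zero)
  have hP1 : (fun i => P i - 1) =O[l] fun i => h i ^ 13 :=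
    ((mono he₂ (by norm_num : 13 ≤ 26)).add (isBigO_const_mul_pow (-(1 / p)) hx)).congr_left
      fun i => by simp only [e₂]; ring
  have hDen : (fun i => Den i - r i) =O[l] fun i => h i ^ 13 := by
    refine (((isBigO_mul_pow hΔ (one hP0)).add (mono (isBigO_mul_pow hr6 hP1)
      (by norm_num : 13 ≤ 6 + 13))).add
      (mono (isBigO_mul_pow hLN6 hρq) (by norm_num : 13 ≤ 6 + 8))).congr_left fun i => ?_
    simp only [Den, div_eq_mul_inv]; ring
  have hDen6 : Den =O[l] fun i => h i ^ 6 :=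
    ((mono hDen (by norm_num : 6 ≤ 13)).add hr6).congr_left fun i => by ring
  have hm : Tendsto (fun i => 2 / ((p - 1) * (1 + r i))) l (𝓝 (2 / ((p - 1) * (1 + 0)))) :=
    tendsto_const_nhds.div ((hr0.const_add 1).const_mul (p - 1)) (by
      have : p - 1 ≠ 0 := by linarith
      simpa using this)
  have hr1 : ∀ᶠ i in l, 0 < 1 + r i := by
    filter_upwards [h0] with i hi
    rw [hr]; positivity
  have hp0 : p ≠ 0 := by linarith
  have hp1 : p - 1 ≠ 0 := by linarith
  have hNum : (fun i => Num i - (r i * (-(2 / ((p - 1) * (1 + r i))) * δ i)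
      - 2 * (1 + 1 / p) * (r i * ρ i))) =O[l] fun i => h i ^ 20 := by
    have t₁ : (fun i => r i * e₁ i * (1 + 1 / p * (1 - r i) * (1 + r i)⁻¹)) =O[l]
        fun i => h i ^ 20 :=
      isBigO_mul_pow (isBigO_mul_pow hr6 he₁)
        (one ((((hr0.const_sub 1).const_mul (1 / p)).mul hinv).const_add 1))
    have t₂ : (fun i => 1 / p * (Δ i * x i)) =O[l] fun i => h i ^ 20 :=
      isBigO_const_mul_pow (1 / p) (mono (isBigO_mul_pow hΔ hx) (by norm_num : 20 ≤ 13 + 13))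
    have hΔ0 : Tendsto Δ l (𝓝 0) := tendsto_zero_of_isBigO_pow hh (by norm_num) hΔ
    have t₃ : (fun i => e₂ i * (1 - r i - Δ i)) =O[l] fun i => h i ^ 20 :=
      mono (isBigO_mul_pow he₂ (one ((hr0.const_sub 1).sub hΔ0))) (by norm_num : 20 ≤ 26 + 0)
    have t₄ := mono (isBigO_mul_pow hLN hρq) (by norm_num : 20 ≤ 12 + 8)
    have t₅ := mono (isBigO_mul_pow hr6 hρqd) (by norm_num : 20 ≤ 6 + 15)
    refine ((((t₂.sub t₁).add t₃).sub (isBigO_const_mul_pow 2 t₄)).sub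
      (isBigO_const_mul_pow (2 * (1 + 1 / p)) t₅)).congr' ?_ EventuallyEq.rfl
    filter_upwards [hr1, hρ1] with i h1 h2
    have hPi : P i = 1 + -(1 / p) * x i + e₂ i := by simp only [e₂]; ring
    have hxi : x i = r i * (qc p * δ i + e₁ i) / (1 + r i) := by rw [← hΔe]
    simp only [Num, LN, hPi]
    rw [hxi, hΔe, qc]
    field_simp
    ring
  have hX : (fun i => Num i + 2 * alphac p * ρ' i * Den i
      + 2 / ((p - 1) * (1 + r i)) * ε i * Den i) =O[l] fun i => h i ^ 20 := by
    have t₁ := mono (isBigO_mul_pow (isBigO_mul_pow hr6 (isBigO_mul_pow hr6 hρ)) (one hinv))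
      (by norm_num : 20 ≤ 6 + (6 + 8) + 0)
    have t₂ := mono (isBigO_mul_pow hρ'8 hDen) (by norm_num : 20 ≤ 8 + 13)
    have t₃ := mono (isBigO_mul_pow hρd hr6) (by norm_num : 20 ≤ 15 + 6)
    have t₄ := isBigO_mul_pow (isBigO_mul_pow (one hm) hε) hDen
    refine ((((hNum.sub (isBigO_const_mul_pow (4 / p) t₁)).add
      (isBigO_const_mul_pow (2 * alphac p) t₂)).add
      (isBigO_const_mul_pow (2 * alphac p) t₃)).add t₄).congr' ?_ EventuallyEq.rfl
    filter_upwards [hr1] with i h1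
    rw [hδε, alphac]
    field_simp
    ring
  have hDlow : ∀ᶠ i in l, 1 / 2 * h i ^ 6 ≤ Den i := by
    have h13 : (fun i => h i ^ 13) =o[l] fun i => h i ^ 6 :=
      (isLittleO_pow_pow (𝕜 := ℝ) (by norm_num : 6 < 13)).comp_tendsto hh
    filter_upwards [(hDen.trans_isLittleO h13).bound (show (0 : ℝ) < 1 / 2 by norm_num), h0]
      with i h1 h2
    rw [Real.norm_of_nonneg (by positivity : 0 ≤ h i ^ 6), Real.norm_eq_abs, hr] at h1
    linarith [(abs_le.1 h1).1]
  refine (isBigO_div_pow (by norm_num : 20 = 6 + 14) h0 hX (by norm_num) hDlow).congr' ?_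
    EventuallyEq.rfl
  have hx1 : ∀ᶠ i in l, 0 < 1 + x i := by
    have := hx0.const_add 1
    exact this.eventually_const_lt (by norm_num)
  filter_upwards [h0, hDlow, hx1] with i h1 h2 h3
  have hDp : 0 < Den i := lt_of_lt_of_le (by positivity) h2
  have hri : 0 < r i := by rw [hr]; positivity
  have hLp : 0 < L i := Real.rpow_pos_of_pos (by linarith) _
  have hP' := one_add_nextR_rpow (p := p) hri h3
  have hS := slowN_eq (p := p) hri (δ i)
  have hrΔ : r i + Δ i = nextR p (r i) (δ i) := by simp only [Δ]; ring
  have hDen' : Den i = L i * nextDen p (r i) (δ i) (ρ' i) := by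
    simp only [Den, nextDen, mul_add]
    rw [hrΔ, show LN i = _ from hS.symm, show P i = _ from hP'.symm]
    ring
  have hNum' : Num i = L i * (slowN p (r i) (δ i) * ((1 - ρ' i) / (1 + ρ' i))
      - slowN p (nextR p (r i) (δ i)) 0) := by
    simp only [Num]
    rw [hrΔ, show LN i = _ from hS.symm, show P i = _ from hP'.symm, slowN.eq_def p (nextR _ _ _)]
    ring
  have : nextDelta p (r i) (δ i) (ρ' i) = Num i / Den i := by
    rw [nextDelta, hNum', hDen', mul_div_mul_left _ _ hLp.ne']
  rw [this]
  field_simp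

end Recurrence

section Region

variable {ι : Type*} {l : Filter ι} {p : ℝ}

lemma tendsto_slowN_div {r δ : ι → ℝ} (hr : Tendsto r l (𝓝 0)) (hr0 : ∀ᶠ i in l, 0 < r i)
    (hδ : Tendsto δ l (𝓝 0)) :
    Tendsto (fun i => slowN p (r i) (δ i) / r i) l (𝓝 (1 + 1 / p)) := by
  have hd : HasDerivAt (fun x : ℝ => (1 + x) ^ (1 / p)) (1 / p) 0 := by
    have := ((hasDerivAt_id (0 : ℝ)).const_add 1).rpow_const (p := 1 / p) (by simp)
    simpa using this
  have hslope := (hasDerivAt_iff_tendsto_slope_zero.1 hd).comp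
    (tendsto_nhdsWithin_iff.2 ⟨hr, hr0.mono fun i hi => hi.ne'⟩)
  have hL : Tendsto (fun i => (1 + r i) ^ (1 / p)) l (𝓝 1) := by
    have h1 : Tendsto (fun i => 1 + r i) l (𝓝 1) := by simpa using hr.const_add 1
    simpa using h1.rpow_const (p := 1 / p) (Or.inl one_ne_zero)
  have := (hslope.add (hδ.const_add 1)).div hL one_ne_zero
  rw [show (1 / p + (1 + 0)) / 1 = 1 + 1 / p by ring] at this
  refine this.congr' ?_
  filter_upwards [hr0] with i hi
  have hLp : (0 : ℝ) < (1 + r i) ^ (1 / p) := Real.rpow_pos_of_pos (by linarith) _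
  have h1 := slowN_eq (p := p) hi (δ i)
  simp only [Pi.div_apply, Function.comp, zero_add, add_zero, smul_eq_mul, Real.one_rpow]
  rw [div_eq_div_iff hLp.ne' hi.ne']
  field_simp
  linarith

/-- The region in which the relative change of slope stays close to its drift. -/
def InRegion (p r δ : ℝ) : Prop := |δ + 2 * alphac p * slopeSq p r| ≤ r ^ (7 / 6 : ℝ)

lemma slopeSq_nextR (hp : 3 ≤ p) {r δ : ℝ} (hr : 0 < r) (hδ : 0 < 1 + δ) :
    slopeSq p (nextR p r δ) = slopeSq p r * (1 + δ) ^ 2 := by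
  have h1 : qc p * (2 * alphac p) = (2 : ℕ) := by
    have : p ≠ 0 := by linarith
    have : p - 1 ≠ 0 := by linarith
    rw [qc, alphac]; field_simp; norm_num
  rw [slopeSq, nextR, Real.mul_rpow hr.le (Real.rpow_nonneg hδ.le _), ← Real.rpow_mul hδ.le, h1,
    Real.rpow_natCast, slopeSq]

lemma slopeSq_pow_six_isBigO (hp : 3 ≤ p) {h : ι → ℝ} (hh : Tendsto h l (𝓝 0))
    (h0 : ∀ᶠ i in l, 0 < h i) :
    (fun i => slopeSq p (h i ^ 6)) =O[l] fun i => h i ^ 8 := by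
  refine IsBigO.of_bound 1 ?_
  filter_upwards [h0, hh.eventually_le_const zero_lt_one] with i hi hi1
  have hα : 4 / 3 ≤ 2 * alphac p := by
    rw [alphac, mul_div_assoc', le_div_iff₀ (by linarith)]; linarith
  have h1 : (h i ^ 6 : ℝ) ^ (4 / 3 : ℝ) = h i ^ 8 := by
    rw [← Real.rpow_natCast, ← Real.rpow_natCast, ← Real.rpow_mul hi.le]; norm_num
  rw [one_mul, Real.norm_of_nonneg (by unfold slopeSq; positivity),
    Real.norm_of_nonneg (by positivity), ← h1]
  exact Real.rpow_le_rpow_of_exponent_ge (by positivity) (pow_le_one₀ hi.le hi1) hα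

lemma exists_region (hp : 3 ≤ p) : ∃ r₁ > (0 : ℝ), ∀ r δ : ℝ, 0 < r → r ≤ r₁ →
    InRegion p r δ →
      InRegion p (nextR p r δ) (nextDelta p r δ (slopeSq p (nextR p r δ))) ∧
      r ≤ slowN p r δ ∧ nextR p r δ ≤ 2 * r ∧ |δ| ≤ 1 / 2 ∧ slopeSq p r ≤ 1 / 4 := by
  let S : Set (ℝ × ℝ) := {z | |z.2 + 2 * alphac p * slopeSq p (z.1 ^ 6)| ≤ z.1 ^ 7}
  let l : Filter (ℝ × ℝ) := comap Prod.fst (𝓝[>] 0) ⊓ 𝓟 S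
  let h : ℝ × ℝ → ℝ := Prod.fst
  have hfst : Tendsto h l (𝓝[>] 0) := tendsto_comap.mono_left inf_le_left
  have hh : Tendsto h l (𝓝 0) := hfst.mono_right nhdsWithin_le_nhds
  have h0 : ∀ᶠ z in l, 0 < h z := hfst.eventually self_mem_nhdsWithin
  have hS : ∀ᶠ z in l, z ∈ S := mem_inf_of_right (mem_principal_self S)
  let ε : ℝ × ℝ → ℝ := fun z => z.2 + 2 * alphac p * slopeSq p (z.1 ^ 6)
  have hε : ε =O[l] fun z => h z ^ 7 := by
    refine IsBigO.of_bound 1 ?_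
    filter_upwards [hS, h0] with z hz hz0
    rw [one_mul, Real.norm_of_nonneg (by positivity : 0 ≤ h z ^ 7)]
    exact hz
  let ρ : ℝ × ℝ → ℝ := fun z => slopeSq p (z.1 ^ 6)
  have hρ : ρ =O[l] fun z => h z ^ 8 := slopeSq_pow_six_isBigO hp hh h0
  have hδ : (fun z : ℝ × ℝ => z.2) =O[l] fun z => h z ^ 7 :=
    (hε.sub (isBigO_const_mul_pow (2 * alphac p)
      (isBigO_pow_of_le hh hρ (by norm_num : 7 ≤ 8)))).congr_left fun z => by
        simp only [ε, ρ]; ring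
  have hδ0 := tendsto_zero_of_isBigO_pow hh (by norm_num) hδ
  have main := nextDelta_isBigO hp hh h0 hε hρ (r := fun z => z.1 ^ 6) (δ := fun z => z.2)
    (ρ' := fun z => ρ z * (1 + z.2) ^ 2) (fun _ => rfl) (fun z => by simp only [ε, ρ]; ring)
    (fun _ => rfl)
  have h1314 : (fun z => h z ^ 14) =o[l] fun z => h z ^ 13 :=
    (isLittleO_pow_pow (𝕜 := ℝ) (by norm_num : 13 < 14)).comp_tendsto hh
  have h67 : (fun z => h z ^ 7) =o[l] fun z => h z ^ 6 :=
    (isLittleO_pow_pow (𝕜 := ℝ) (by norm_num : 6 < 7)).comp_tendsto hh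
  have main' := (main.trans_isLittleO h1314).bound (show (0 : ℝ) < 1 / 4 by norm_num)
  have hpow : (fun z : ℝ × ℝ => (1 + z.2) ^ (qc p * (7 / 6)) - 1) =O[l] fun z => h z ^ 7 := by
    have h1 := ((one_add_rpow_isBigO_sq (qc p * (7 / 6))).comp_tendsto hδ0).trans (hδ.pow 2)
    have h2 := isBigO_pow_of_le hh (h1.congr_right fun i => (pow_mul _ _ _).symm)
      (by norm_num : 7 ≤ 7 * 2)
    exact (h2.add (isBigO_const_mul_pow (qc p * (7 / 6)) hδ)).congr_left fun z => by
      simp only [Function.comp]; ring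
  have hpow' := (hpow.trans_isLittleO h67).bound (show (0 : ℝ) < 1 / 4 by norm_num)
  have hr : Tendsto (fun z : ℝ × ℝ => z.1 ^ 6) l (𝓝 0) := by simpa using hh.pow 6
  have hN := tendsto_slowN_div (p := p) hr (h0.mono fun z hz => pow_pos hz 6) hδ0
  have hpinv : 0 < 1 / p := by positivity
  have hN' := hN.eventually_const_le (show (1 : ℝ) < 1 + 1 / p by linarith)
  have hq : Tendsto (fun z : ℝ × ℝ => (1 + z.2) ^ qc p) l (𝓝 1) := by
    have h1 : Tendsto (fun z : ℝ × ℝ => 1 + z.2) l (𝓝 1) := by simpa using hδ0.const_add 1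
    simpa using h1.rpow_const (p := qc p) (Or.inl one_ne_zero)
  have hq' := hq.eventually_le_const (show (1 : ℝ) < 2 by norm_num)
  have hδ' := hδ0.abs.eventually_le_const (show |(0 : ℝ)| < 1 / 2 by norm_num)
  have hρ' := (tendsto_zero_of_isBigO_pow hh (by norm_num) hρ).eventually_le_const
    (show (0 : ℝ) < 1 / 4 by norm_num)
  have key : ∀ᶠ z in l, InRegion p (nextR p (z.1 ^ 6) z.2)
        (nextDelta p (z.1 ^ 6) z.2 (slopeSq p (nextR p (z.1 ^ 6) z.2))) ∧
      z.1 ^ 6 ≤ slowN p (z.1 ^ 6) z.2 ∧ nextR p (z.1 ^ 6) z.2 ≤ 2 * z.1 ^ 6 ∧ |z.2| ≤ 1 / 2 ∧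
      slopeSq p (z.1 ^ 6) ≤ 1 / 4 := by
    filter_upwards [main', hpow', hN', hq', hδ', hρ', h0, hS,
      hh.eventually_le_const zero_lt_one] with z k1 k2 k3 k4 k5 k6 k7 k8 k9
    have k7' : 0 < z.1 := k7
    have hz6 : 0 < z.1 ^ 6 := pow_pos k7 6
    have hδ1 : 0 < 1 + z.2 := by linarith [(abs_le.1 k5).1]
    refine ⟨?_, ?_, ?_, k5, k6⟩
    · rw [InRegion, slopeSq_nextR hp hz6 hδ1]
      have e1 : nextR p (z.1 ^ 6) z.2 ^ (7 / 6 : ℝ) = z.1 ^ 7 * (1 + z.2) ^ (qc p * (7 / 6)) := by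
        have e2 : (z.1 ^ 6) ^ (7 / 6 : ℝ) = z.1 ^ 7 := by
          rw [← Real.rpow_natCast, ← Real.rpow_natCast, ← Real.rpow_mul k7'.le]; norm_num
        rw [nextR, Real.mul_rpow hz6.le (Real.rpow_nonneg hδ1.le _), ← Real.rpow_mul hδ1.le, e2]
      have hb : |2 / ((p - 1) * (1 + z.1 ^ 6)) * ε z| ≤ (1 - z.1 ^ 6 / 2) * z.1 ^ 7 := by
        have c0 : 0 < (p - 1) * (1 + z.1 ^ 6) := mul_pos (by linarith) (by positivity)
        have c1 : 2 / ((p - 1) * (1 + z.1 ^ 6)) ≤ 1 - z.1 ^ 6 / 2 := by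
          have c2 : z.1 ^ 6 ≤ 1 := pow_le_one₀ k7'.le k9
          rw [div_le_iff₀ c0]
          nlinarith [mul_nonneg (show 0 ≤ p - 3 by linarith)
            (show 0 ≤ (1 - z.1 ^ 6 / 2) * (1 + z.1 ^ 6) by nlinarith)]
        rw [abs_mul, abs_of_nonneg (by positivity)]
        have c3 : |ε z| ≤ z.1 ^ 7 := k8
        have c4 : 0 ≤ 2 / ((p - 1) * (1 + z.1 ^ 6)) := by positivity
        exact mul_le_mul c1 c3 (abs_nonneg _) (c4.trans c1)
      simp only [h, Real.norm_eq_abs, abs_of_pos (pow_pos k7' _)] at k1 k2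
      rw [e1]
      have k2' : 1 - 1 / 4 * z.1 ^ 6 ≤ (1 + z.2) ^ (qc p * (7 / 6)) := by
        linarith [(abs_le.1 k2).1]
      have k1' := abs_le.1 k1
      have hb' := abs_le.1 hb
      have e3 : z.1 ^ 7 * (1 - 1 / 4 * z.1 ^ 6) ≤ z.1 ^ 7 * (1 + z.2) ^ (qc p * (7 / 6)) := by
        gcongr
      have e4 : z.1 ^ 13 = z.1 ^ 7 * z.1 ^ 6 := by ring
      rw [abs_le]
      constructor <;> nlinarith [k1'.1, k1'.2, hb'.1, hb'.2]
    · rwa [le_div_iff₀ hz6, one_mul] at k3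
    · rw [nextR, mul_comm 2]; gcongr
  rw [eventually_inf_principal, eventually_comap] at key
  obtain ⟨h₁, hh₁, hsub⟩ := mem_nhdsGT_iff_exists_Ioc_subset.1 key
  have hh₁' : 0 < h₁ := hh₁
  refine ⟨h₁ ^ 6, by positivity, fun r δ hr0 hr1 hreg => ?_⟩
  have hr6 : (r ^ (1 / 6 : ℝ)) ^ 6 = r := by
    rw [← Real.rpow_natCast, ← Real.rpow_mul hr0.le]; norm_num
  have hr7 : (r ^ (1 / 6 : ℝ)) ^ 7 = r ^ (7 / 6 : ℝ) := by
    rw [← Real.rpow_natCast, ← Real.rpow_mul hr0.le]; norm_num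
  have hmem : r ^ (1 / 6 : ℝ) ∈ Set.Ioc 0 h₁ := by
    have h1 : 0 < r ^ (1 / 6 : ℝ) := by positivity
    exact ⟨h1, le_of_pow_le_pow_left₀ (by norm_num : 6 ≠ 0) hh₁'.le (by rw [hr6]; exact hr1)⟩
  have := hsub hmem (r ^ (1 / 6 : ℝ), δ) rfl (by
    simp only [S, Set.mem_ofPred_eq, hr6, hr7]; exact hreg)
  simpa only [hr6] using this

end Region

section Initial

/-- The relative change of slope produced by one line search from `(1 - u, u R)`, `r = R ^ q`. -/
def lineDelta (p u r : ℝ) : ℝ :=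
  (u - (1 - (1 + r) ^ (-(1 / p)))) / (r * (1 + r) ^ (-(1 / p)) + u * slopeSq p r) - 1

lemma slowN_lineDelta {p u r : ℝ} (hu : 0 < u) (hr : 0 < r) :
    u * (1 - slopeSq p r * (1 + lineDelta p u r)) = slowN p r (lineDelta p u r) := by
  have h1 : 0 < r * (1 + r) ^ (-(1 / p)) + u * slopeSq p r := by
    have : 0 < (1 + r) ^ (-(1 / p)) := Real.rpow_pos_of_pos (by linarith) _
    have : 0 ≤ slopeSq p r := Real.rpow_nonneg hr.le _
    positivity
  have h2 : (1 + lineDelta p u r) * (r * (1 + r) ^ (-(1 / p)) + u * slopeSq p r) =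
      u - (1 - (1 + r) ^ (-(1 / p))) := by
    unfold lineDelta
    field_simp
    ring
  unfold slowN
  linear_combination (-1) * h2

lemma lineDelta_eq {p u r : ℝ} (hu : 0 < u) (hr : 0 < r) :
    lineDelta p u r = ((1 + r) ^ (1 / p) * u - (1 + r) ^ (1 / p) + 1 - r
      - (1 + r) ^ (1 / p) * u * slopeSq p r) / (r + (1 + r) ^ (1 / p) * u * slopeSq p r) := by
  have h0 : 0 < (1 + r) ^ (1 / p) := Real.rpow_pos_of_pos (by linarith) _
  have h1 : 0 ≤ slopeSq p r := Real.rpow_nonneg hr.le _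
  have h2 : 0 < r * ((1 + r) ^ (1 / p))⁻¹ + u * slopeSq p r := by positivity
  have h3 : 0 < r + (1 + r) ^ (1 / p) * u * slopeSq p r := by positivity
  rw [lineDelta, Real.rpow_neg (by linarith)]
  rw [div_sub_one h2.ne', div_eq_div_iff h2.ne' h3.ne']
  field_simp
  ring

/-- The normalized initial value `(C_p + D_p u) ^ q` of `r / u`. -/
def initScale (p u : ℝ) : ℝ := (Cp p + Dp p * u) ^ qc p

lemma Cp_pos {p : ℝ} (hp : 3 ≤ p) : 0 < Cp p :=
  Real.rpow_pos_of_pos (div_pos (by linarith) (by linarith)) _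

lemma Dp_pos {p : ℝ} (hp : 3 ≤ p) : 0 < Dp p := by
  have := Cp_pos hp
  have : 0 < p - 1 := by linarith
  have : 0 < p := by linarith
  unfold Dp
  positivity

lemma initScale_eq {p u : ℝ} (hp : 3 ≤ p) (hu : 0 < u) :
    initScale p u = p / (p + 1) *
      (1 + (p - 1) * (3 * p + 1) / (2 * p * (p + 1) ^ 2) * u) ^ qc p := by
  have h1 : Cp p ^ qc p = p / (p + 1) := by
    have hq : qc p ≠ 0 := by
      have : 0 < p - 1 := by linarith
      have : 0 < p := by linarith
      unfold qc; positivity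
    rw [Cp, ← Real.rpow_mul (div_nonneg (by linarith) (by linarith)), one_div_mul_cancel hq,
      Real.rpow_one]
  have h2 : Cp p + Dp p * u =
      Cp p * (1 + (p - 1) * (3 * p + 1) / (2 * p * (p + 1) ^ 2) * u) := by
    unfold Dp; ring
  have h3 : 0 ≤ 1 + (p - 1) * (3 * p + 1) / (2 * p * (p + 1) ^ 2) * u := by
    have : 0 < p - 1 := by linarith
    have : 0 < p := by linarith
    positivity
  rw [initScale, h2, Real.mul_rpow (Cp_pos hp).le h3, h1]

lemma exists_initial {p : ℝ} (hp : 3 ≤ p) {r₁ : ℝ} (hr₁ : 0 < r₁) : ∃ u₁ > (0 : ℝ), ∀ u : ℝ, 0 < u →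
    u ≤ u₁ → initScale p u * u ≤ r₁ ∧
      InRegion p (initScale p u * u) (lineDelta p u (initScale p u * u)) := by
  have hp0 : p ≠ 0 := by linarith
  have hp1 : p - 1 ≠ 0 := by linarith
  have hp2 : p + 1 ≠ 0 := by linarith
  let l : Filter ℝ := 𝓝[>] 0
  let h : ℝ → ℝ := id
  have hh : Tendsto h l (𝓝 0) := tendsto_id.mono_left nhdsWithin_le_nhds
  have h0 : ∀ᶠ x in l, 0 < h x := self_mem_nhdsWithin
  have mono := fun {f : ℝ → ℝ} {m n : ℕ} => isBigO_pow_of_le (f := f) (m := m) (n := n) hh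
  have one : ∀ {f : ℝ → ℝ} {c : ℝ}, Tendsto f l (𝓝 c) → f =O[l] fun i => h i ^ 0 := by
    intro f c hf
    simpa using hf.isBigO_one ℝ
  let u : ℝ → ℝ := fun x => x ^ 6
  have hu : u =O[l] fun x => h x ^ 6 := isBigO_refl _ _
  have hu0 : Tendsto u l (𝓝 0) := tendsto_zero_of_isBigO_pow hh (by norm_num) hu
  have hup : ∀ᶠ x in l, 0 < u x := h0.mono fun x hx => pow_pos hx 6
  let s : ℝ → ℝ := fun x => initScale p (u x)
  let s₀ := p / (p + 1)
  let k := (p - 1) * (3 * p + 1) / (2 * p * (p + 1) ^ 2)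
  have hs : (fun x => s x - s₀ * (1 + qc p * (k * u x))) =O[l] fun x => h x ^ 12 := by
    have h1 : (fun x => k * u x) =O[l] fun x => h x ^ 6 := isBigO_const_mul_pow k hu
    have h2 := ((one_add_rpow_isBigO_sq (qc p)).comp_tendsto
      (tendsto_zero_of_isBigO_pow hh (by norm_num) h1)).trans (h1.pow 2)
    refine (isBigO_const_mul_pow s₀
      (h2.congr_right fun i => (pow_mul _ _ _).symm)).congr' ?_ EventuallyEq.rfl
    filter_upwards [hup] with x hx
    simp only [s, Function.comp, initScale_eq hp hx]
    ring
  have hs0 : Tendsto s l (𝓝 s₀) := by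
    have h1 := tendsto_zero_of_isBigO_pow hh (by norm_num) hs
    have h2 := h1.add ((((hu0.const_mul k).const_mul (qc p)).const_add 1).const_mul s₀)
    simpa using h2
  let r : ℝ → ℝ := fun x => s x * u x
  have hr : r =O[l] fun x => h x ^ 6 := by
    simpa only [zero_add] using isBigO_mul_pow (one hs0) hu
  have hr0 : Tendsto r l (𝓝 0) := tendsto_zero_of_isBigO_pow hh (by norm_num) hr
  have hs₀ : 0 < s₀ := div_pos (by linarith) (by linarith)
  have hsp : ∀ᶠ x in l, s₀ / 2 ≤ s x := hs0.eventually_const_le (by linarith)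
  have hrp : ∀ᶠ x in l, 0 < r x := by
    filter_upwards [hsp, hup] with x h1 h2
    exact mul_pos (by linarith) h2
  let L : ℝ → ℝ := fun x => (1 + r x) ^ (1 / p)
  have hL1 : Tendsto L l (𝓝 1) := by
    have h1 : Tendsto (fun i => 1 + r i) l (𝓝 1) := by simpa using hr0.const_add 1
    simpa [L] using h1.rpow_const (p := 1 / p) (Or.inl one_ne_zero)
  let e : ℝ → ℝ := fun x =>
    L x - (1 + 1 / p * r x + 1 / p * (1 / p - 1) / 2 * r x ^ 2)
  have he : e =O[l] fun x => h x ^ 18 := by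
    have := ((one_add_rpow_isBigO_cube (1 / p)).comp_tendsto hr0).trans (hr.pow 3)
    exact this.congr_right fun i => (pow_mul _ _ _).symm
  let w : ℝ → ℝ := fun x => r x - s₀ * u x * (1 + qc p * (k * u x))
  have hw : w =O[l] fun x => h x ^ 18 :=
    (isBigO_mul_pow hs hu).congr_left fun x => by simp only [w, r]; ring
  let z : ℝ → ℝ := fun x => r x - s₀ * u x
  have hz : z =O[l] fun x => h x ^ 12 :=
    ((mono hw (by norm_num : 12 ≤ 18)).add
      (isBigO_const_mul_pow (s₀ * qc p * k) (isBigO_mul_pow hu hu))).congr_left fun x => by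
        simp only [w, z]; ring
  have hρ : (fun x => slopeSq p (r x)) =O[l] fun x => h x ^ 8 := by
    have h1 := slopeSq_pow_six_isBigO hp hh h0
    have h2 : (fun x => slopeSq p (s x)) =O[l] fun x => h x ^ 0 :=
      one (hs0.rpow_const (Or.inl hs₀.ne'))
    refine (isBigO_mul_pow h2 h1).congr' ?_ (by simp)
    filter_upwards [hsp, hup] with x h3 h4
    simp only [slopeSq, r]
    rw [Real.mul_rpow (by linarith) h4.le]
    rfl
  have hNum : (fun x => L x * u x - L x + 1 - r x) =O[l] fun x => h x ^ 18 := by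
    have t₁ := isBigO_mul_pow hu (isBigO_mul_pow hr hr)
    have t₂ : (fun x => e x * (u x - 1)) =O[l] fun x => h x ^ 18 :=
      isBigO_mul_pow he (one (hu0.sub_const 1))
    have t₃ := isBigO_mul_pow hu hz
    have t₄ := mono (isBigO_mul_pow hz hz) (by norm_num : 18 ≤ 12 + 12)
    let b := 1 / p * (1 / p - 1) / 2
    refine (((((isBigO_const_mul_pow b t₁).add t₂).sub (isBigO_const_mul_pow (1 + 1 / p) hw)).add
      (isBigO_const_mul_pow (1 / p - b * 2 * s₀) t₃)).sub
      (isBigO_const_mul_pow b t₄)).congr_left fun x => ?_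
    have hL : L x = 1 + 1 / p * r x + 1 / p * (1 / p - 1) / 2 * r x ^ 2 + e x := by
      simp only [e]; ring
    rw [hL]
    simp only [w, z, b, s₀, k, qc]
    field_simp
    ring
  have hδ : (fun x => lineDelta p (u x) (r x)) =O[l] fun x => h x ^ 8 := by
    have h1 := (mono hNum (by norm_num : 14 ≤ 18)).sub
      (isBigO_mul_pow (isBigO_mul_pow (one hL1) hu) hρ)
    refine (isBigO_div_pow (D := fun x => r x + L x * u x * slopeSq p (r x))
      (by norm_num : 14 = 6 + 8) h0 h1 (show 0 < s₀ / 2 by positivity) ?_).congr' ?_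
      EventuallyEq.rfl
    · filter_upwards [hsp, hup, hrp] with x h1 h2 h3
      have h4 : 0 < L x := Real.rpow_pos_of_pos (by linarith) _
      have h5 : 0 ≤ slopeSq p (r x) := Real.rpow_nonneg h3.le _
      have h6 : s₀ / 2 * u x ≤ r x := by simp only [r]; gcongr
      have h7 : 0 ≤ L x * u x * slopeSq p (r x) := by positivity
      exact h6.trans (by linarith)
    · filter_upwards [hup, hrp] with x h1 h2
      rw [lineDelta_eq h1 h2]
  have hreg := (hδ.add (isBigO_const_mul_pow (2 * alphac p) hρ)).trans_isLittleO
    ((isLittleO_pow_pow (𝕜 := ℝ) (by norm_num : 7 < 8)).comp_tendsto hh)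
  have hreg' := hreg.bound (show 0 < (s₀ / 2) ^ (7 / 6 : ℝ) by positivity)
  have key : ∀ᶠ x in l, r x ≤ r₁ ∧ InRegion p (r x) (lineDelta p (u x) (r x)) := by
    filter_upwards [hr0.eventually_le_const hr₁, hreg', h0, hsp] with x h1 h2 h3 h4
    refine ⟨h1, ?_⟩
    have h3' : 0 < x := h3
    have e2 : (x ^ 6) ^ (7 / 6 : ℝ) = x ^ 7 := by
      rw [← Real.rpow_natCast, ← Real.rpow_natCast, ← Real.rpow_mul h3'.le]; norm_num
    have e3 : (s₀ / 2) ^ (7 / 6 : ℝ) * x ^ 7 ≤ r x ^ (7 / 6 : ℝ) := by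
      rw [← e2, ← Real.mul_rpow (by positivity) (by positivity)]
      apply Real.rpow_le_rpow (by positivity) _ (by norm_num)
      simp only [r, u]; gcongr
    refine le_trans ?_ e3
    simpa [h, abs_of_pos h3'] using h2
  obtain ⟨h₁, hh₁, hsub⟩ := mem_nhdsGT_iff_exists_Ioc_subset.1 key
  have hh₁' : 0 < h₁ := hh₁
  refine ⟨h₁ ^ 6, by positivity, fun v hv0 hv1 => ?_⟩
  have hr6 : (v ^ (1 / 6 : ℝ)) ^ 6 = v := by
    rw [← Real.rpow_natCast, ← Real.rpow_mul hv0.le]; norm_num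
  have hmem : v ^ (1 / 6 : ℝ) ∈ Set.Ioc 0 h₁ := by
    have h1 : 0 < v ^ (1 / 6 : ℝ) := by positivity
    exact ⟨h1, le_of_pow_le_pow_left₀ (by norm_num : 6 ≠ 0) hh₁'.le (by rw [hr6]; exact hv1)⟩
  have := hsub hmem
  simpa only [Set.mem_ofPred_eq, r, s, u, hr6] using this

end Initial

section Step

variable {p : ℝ}

lemma tangent_le_abs_rpow (hp : 1 < p) {a : ℝ} (ha : 0 < a) (x : ℝ) :
    a ^ p + p * (a ^ p / a) * (x - a) ≤ |x| ^ p := by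
  have hap : 0 < a ^ p := Real.rpow_pos_of_pos ha p
  rcases lt_or_ge x 0 with hx | hx
  · refine le_trans ?_ (Real.rpow_nonneg (abs_nonneg x) p)
    have h1 : a ^ p + p * (a ^ p / a) * (x - a) = a ^ p * (1 - p) + p * (a ^ p / a) * x := by
      field_simp; ring
    have h2 : 0 < p * (a ^ p / a) := by positivity
    rw [h1]
    nlinarith
  · have h1 := one_add_mul_self_le_rpow_one_add (s := x / a - 1)
      (by linarith [div_nonneg hx ha.le]) hp.le
    rw [add_sub_cancel, Real.div_rpow hx ha.le, le_div_iff₀ hap] at h1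
    rw [abs_of_nonneg hx]
    refine le_of_eq_of_le ?_ h1
    field_simp

lemma tangent_lt_abs_rpow (hp : 1 < p) {a : ℝ} (ha : 0 < a) {x : ℝ} (hx : x ≠ a) :
    a ^ p + p * (a ^ p / a) * (x - a) < |x| ^ p := by
  have hap : 0 < a ^ p := Real.rpow_pos_of_pos ha p
  rcases lt_or_ge x 0 with hx' | hx'
  · refine lt_of_lt_of_le ?_ (Real.rpow_nonneg (abs_nonneg x) p)
    have h1 : a ^ p + p * (a ^ p / a) * (x - a) = a ^ p * (1 - p) + p * (a ^ p / a) * x := by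
      field_simp; ring
    have h2 : 0 < p * (a ^ p / a) := by positivity
    rw [h1]
    nlinarith
  · have h1 := one_add_mul_self_lt_rpow_one_add (s := x / a - 1)
      (by linarith [div_nonneg hx' ha.le])
      (fun h => hx ((div_eq_one_iff_eq ha.ne').1 (sub_eq_zero.1 h))) hp
    rw [add_sub_cancel, Real.div_rpow hx' ha.le, lt_div_iff₀ hap] at h1
    rw [abs_of_nonneg hx']
    refine lt_of_eq_of_lt ?_ h1
    field_simp

/-- A maximizer of a linear form on `B_p` is the unique point where the form is normal to `B_p`. -/
lemma eq_of_linear_max (hp : 1 < p) {a b R : ℝ} (ha : 0 < a) (hb : 0 < b)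
    (hab : a ^ p + b ^ p = 1) (hR : b ^ p / b = R * (a ^ p / a)) {z : ℝ × ℝ} (hz : inBp p z)
    (hopt : a + R * b ≤ z.1 + R * z.2) : z = (a, b) := by
  have h0 : 0 ≤ p * (a ^ p / a) * ((z.1 - a) + R * (z.2 - b)) := by
    have : 0 < p * (a ^ p / a) := by
      have := Real.rpow_pos_of_pos ha p
      positivity
    exact mul_nonneg this.le (by linarith)
  have h1 := tangent_le_abs_rpow hp ha z.1
  have h2 := tangent_le_abs_rpow hp hb z.2
  have hz' : |z.1| ^ p + |z.2| ^ p ≤ 1 := hz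
  rw [hR] at h2
  by_contra hne
  have h3 : z.1 ≠ a ∨ z.2 ≠ b := by
    by_contra! h
    exact hne (Prod.ext h.1 h.2)
  rcases h3 with h | h
  · have := tangent_lt_abs_rpow hp ha h
    nlinarith
  · have := tangent_lt_abs_rpow hp hb h
    rw [hR] at this
    nlinarith

/-- The exact line search for a quadratic with interior minimizer. -/
lemma eq_of_quadratic_min {c D s₀ γ : ℝ} (hD : 0 < D) (hs : s₀ ∈ Set.Icc (0 : ℝ) 1)
    (h : ∀ s ∈ Set.Icc (0 : ℝ) 1, c + D * (γ - s₀) ^ 2 ≤ c + D * (s - s₀) ^ 2) : γ = s₀ := by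
  have := h s₀ hs
  have h1 : (γ - s₀) ^ 2 = 0 := by nlinarith [sq_nonneg (γ - s₀)]
  linarith [pow_eq_zero_iff (two_ne_zero) |>.1 h1]

/-- One Frank–Wolfe step for `f` from `(1 - u, σ R u)`, in terms of `r = R ^ q`. -/
lemma fw_step (hp : 3 ≤ p) {r δ u σ : ℝ} (hr : 0 < r) (hδ : 0 < 1 + δ) (hu : 0 < u)
    (hrel : u * (1 - slopeSq p r * (1 + δ)) = slowN p r δ) (hN : 0 < slowN p r δ)
    (hσ : σ ^ 2 = 1) {v : ℝ × ℝ} {γ : ℝ} (hv : inBp p v)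
    (hlmo : ∀ b : ℝ × ℝ, inBp p b →
      -u * v.1 + σ * (r ^ alphac p * u) * v.2 ≤ -u * b.1 + σ * (r ^ alphac p * u) * b.2)
    (hγ : ∀ s ∈ Set.Icc (0 : ℝ) 1, fobj (seg (1 - u, σ * (r ^ alphac p * u)) v γ) ≤
      fobj (seg (1 - u, σ * (r ^ alphac p * u)) v s)) :
    seg (1 - u, σ * (r ^ alphac p * u)) v γ =
      (1 - slowN p r δ / (1 + slopeSq p (nextR p r δ)), -σ * (nextR p r δ ^ alphac p *
        (slowN p r δ / (1 + slopeSq p (nextR p r δ))))) := by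
  have hp0 : 0 < p := by linarith
  have hp1 : 0 < p - 1 := by linarith
  set R := r ^ alphac p with hRdef
  set P := (1 + r) ^ (-(1 / p)) with hPdef
  set B := r ^ (1 / p) * P with hBdef
  have hR : 0 < R := Real.rpow_pos_of_pos hr _
  have hP : 0 < P := Real.rpow_pos_of_pos (by linarith) _
  have hB : 0 < B := mul_pos (Real.rpow_pos_of_pos hr _) hP
  have hρ : slopeSq p r = R ^ 2 := by
    rw [slopeSq, hRdef, ← Real.rpow_natCast, ← Real.rpow_mul hr.le, mul_comm]; norm_num
  have hRB : R * B = r * P := by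
    have : R * r ^ (1 / p) = r := by
      rw [hRdef, ← Real.rpow_add hr, alphac,
        show (p - 1) / p + 1 / p = 1 by field_simp; ring, Real.rpow_one]
    rw [hBdef, ← mul_assoc, this]
  have hPp : P ^ p = 1 / (1 + r) := by
    rw [hPdef, ← Real.rpow_mul (by linarith), show -(1 / p) * p = -1 by field_simp,
      Real.rpow_neg_one, one_div]
  have hBp : B ^ p = r / (1 + r) := by
    rw [hBdef, Real.mul_rpow (Real.rpow_nonneg hr.le _) hP.le, hPp, ← Real.rpow_mul hr.le,
      one_div_mul_cancel hp0.ne', Real.rpow_one, mul_one_div]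
  have hR' : nextR p r δ ^ alphac p = R * (1 + δ) := by
    have : qc p * alphac p = 1 := by
      unfold qc alphac
      have := hp1.ne'
      field_simp
    rw [nextR, Real.mul_rpow hr.le (Real.rpow_nonneg hδ.le _), ← Real.rpow_mul hδ.le, this,
      Real.rpow_one]
  have hρ' : slopeSq p (nextR p r δ) = (R * (1 + δ)) ^ 2 := by
    rw [slopeSq_nextR hp hr hδ, hρ]; ring
  have hv' : v = (P, -σ * B) := by
    have hz : ((v.1, -σ * v.2) : ℝ × ℝ) = (P, B) := by
      have hσa : |σ| = 1 := by
        rw [← sq_eq_sq₀ (abs_nonneg _) zero_le_one, sq_abs, hσ, one_pow]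
      refine eq_of_linear_max (p := p) (R := R) (by linarith) hP hB ?_ ?_ ?_ ?_
      · rw [hPp, hBp]; field_simp
      · rw [hPp, hBp, div_div, div_div, ← mul_div_assoc, mul_one,
          div_eq_div_iff (by positivity) (by positivity)]
        linear_combination (-(1 + r)) * hRB
      · simpa [inBp, abs_mul, hσa] using hv
      · have := hlmo (P, -σ * B) (by
          simp only [inBp, abs_mul, abs_neg, hσa, one_mul, abs_of_pos hP, abs_of_pos hB, hPp, hBp]
          rw [← add_div, div_self (by positivity)])
        simp only at this ⊢
        refine le_of_mul_le_mul_left ?_ hu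
        linear_combination this - R * u * B * hσ
    have h1 := congrArg Prod.fst hz
    have h2 := congrArg Prod.snd hz
    simp only at h1 h2
    refine Prod.ext h1 ?_
    simp only
    linear_combination (-σ) * h2 + (-v.2) * hσ
  have hD2 : 0 < B + u * R := by positivity
  have hD1 : u - 1 + P = (1 + δ) * R * (B + u * R) := by
    rw [hρ, slowN, ← hPdef] at hrel
    linear_combination hrel - (1 + δ) * hRB
  set D2 := B + u * R with hD2def
  set R' := (1 + δ) * R with hR'def
  have hR'0 : 0 < R' := by positivity
  have hslow : u * (1 - R * R') = slowN p r δ := by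
    rw [← hrel, hρ, hR'def]; ring
  have hRR' : 0 < 1 - R * R' := by
    have := hslow ▸ hN
    exact pos_of_mul_pos_right this hu.le
  have hA : 1 - P ≤ B * R := by
    have h1 : 1 ≤ (1 + r) * P := by
      have : (1 + r) * P = (1 + r) ^ (1 - 1 / p) := by
        rw [hPdef, sub_eq_add_neg, Real.rpow_add (by linarith), Real.rpow_one]
      rw [this]
      refine Real.one_le_rpow (by linarith) ?_
      rw [sub_nonneg, div_le_one hp0]; linarith
    linarith
  have hγ' : γ = u * (R' + R) / (D2 * (1 + R' ^ 2)) := by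
    refine eq_of_quadratic_min (c := (u * (1 - R * R')) ^ 2 / (1 + R' ^ 2))
      (D := D2 ^ 2 * (1 + R' ^ 2)) (by positivity) ⟨by positivity, ?_⟩ ?_
    · rw [div_le_one (by positivity)]
      have h1 : (1 - P) * R' ≤ B := by
        calc (1 - P) * R' ≤ B * R * R' := by gcongr
          _ = B - B * (1 - R * R') := by ring
          _ ≤ B := by linarith [mul_pos hB hRR']
      have h2 : D2 * (1 + R' ^ 2) - u * (R' + R) = B - (1 - P) * R' := by
        linear_combination (-R') * hD1 + hD2def
      linarith
    · have key : ∀ s, fobj (seg (1 - u, σ * (R * u)) v s) =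
          (u * (1 - R * R')) ^ 2 / (1 + R' ^ 2) +
            D2 ^ 2 * (1 + R' ^ 2) * (s - u * (R' + R) / (D2 * (1 + R' ^ 2))) ^ 2 := by
        intro s
        have e1 : fobj (seg (1 - u, σ * (R * u)) v s) = (-u + s * (R' * D2)) ^ 2 +
            (R * u - s * D2) ^ 2 := by
          simp only [fobj, seg, hv']
          rw [← hD1, hD2def]
          linear_combination (R * u - s * (B + u * R)) ^ 2 * hσ
        rw [e1]
        field_simp
        ring
      intro s hs
      rw [← key, ← key]
      exact hγ s hs
  have hu' : u - γ * (R' * D2) = slowN p r δ / (1 + R' ^ 2) := by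
    rw [hγ', ← hslow]; field_simp; ring
  have hw' : R * u - γ * D2 = -(R' * (slowN p r δ / (1 + R' ^ 2))) := by
    rw [hγ', ← hslow]; field_simp; ring
  rw [hρ', hR', show R * (1 + δ) = R' by rw [hR'def]; ring, ← hu']
  rw [← hu'] at hw'
  refine Prod.ext ?_ ?_
  · simp only [seg, hv']
    linear_combination γ * hD1
  · simp only [seg, hv']
    linear_combination σ * hw' + γ * σ * hD2def

end Step

section Trajectory

variable {p : ℝ}

lemma slowN_nextDelta {r δ ρ : ℝ} (hden : nextDen p r δ ρ ≠ 0) :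
    slowN p r δ / (1 + ρ) * (1 - ρ * (1 + nextDelta p r δ ρ)) =
      slowN p (nextR p r δ) (nextDelta p r δ ρ) := by
  have h1 : nextDelta p r δ ρ * nextDen p r δ ρ =
      slowN p r δ * ((1 - ρ) / (1 + ρ)) - slowN p (nextR p r δ) 0 := div_mul_cancel₀ _ hden
  have h2 : slowN p (nextR p r δ) (nextDelta p r δ ρ) = slowN p (nextR p r δ) 0 +
      nextDelta p r δ ρ * (nextR p r δ * (1 + nextR p r δ) ^ (-(1 / p))) := by
    unfold slowN; ring
  rw [h2]
  rw [nextDen] at h1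
  have h3 : (1 - ρ) / (1 + ρ) = 1 / (1 + ρ) - ρ / (1 + ρ) := sub_div _ _ _
  rw [h3] at h1
  linear_combination (-1) * h1

/-- The properties of the states of a slow trajectory that determine its rate. -/
structure IsOrbit (p : ℝ) (r δ u : ℕ → ℝ) : Prop where
  r_pos : ∀ t, 0 < r t
  r_le : ∀ t, r t ≤ slowN p (r t) (δ t)
  inRegion : ∀ t, InRegion p (r t) (δ t)
  abs_le_half : ∀ t, |δ t| ≤ 1 / 2
  u_pos : ∀ t, 0 < u t
  u_mul : ∀ t, u t * (1 - slopeSq p (r t) * (1 + δ t)) = slowN p (r t) (δ t)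
  slopeSq_succ : ∀ t, slopeSq p (r (t + 1)) = slopeSq p (r t) * (1 + δ t) ^ 2
  u_succ : ∀ t, u (t + 1) = slowN p (r t) (δ t) / (1 + slopeSq p (r (t + 1)))

/-- The states `(r, δ)` along the trajectory started at relative height `r = R ^ q`. -/
def slowOrbit (p u₀ : ℝ) : ℕ → ℝ × ℝ
  | 0 => (initScale p u₀ * u₀, lineDelta p u₀ (initScale p u₀ * u₀))
  | t + 1 =>
    let s := slowOrbit p u₀ t
    (nextR p s.1 s.2, nextDelta p s.1 s.2 (slopeSq p (nextR p s.1 s.2)))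

lemma gvec_gobj_step {μ θ : ℝ} (hμ : 0 < μ) (hθ : 0 < θ) {z v : ℝ × ℝ} {γ : ℝ} (hz : 0 < fobj z)
    (hlmo : ∀ b : ℝ × ℝ, inBp p b → dot (gvec μ θ z) v ≤ dot (gvec μ θ z) b)
    (hγ : ∀ s ∈ Set.Icc (0 : ℝ) 1, gobj μ θ (seg z v γ) ≤ gobj μ θ (seg z v s)) :
    (∀ b : ℝ × ℝ, inBp p b → (z.1 - 1) * v.1 + z.2 * v.2 ≤ (z.1 - 1) * b.1 + z.2 * b.2) ∧
      ∀ s ∈ Set.Icc (0 : ℝ) 1, fobj (seg z v γ) ≤ fobj (seg z v s) := by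
  have hf : ∀ y, 0 ≤ fobj y := fun y => add_nonneg (sq_nonneg _) (sq_nonneg _)
  have hμ' : 0 < μ ^ (-(1 / θ)) := Real.rpow_pos_of_pos hμ _
  constructor
  · intro b hb
    have hκ : 0 < μ ^ (-(1 / θ)) * (1 / θ) * fobj z ^ (1 / (2 * θ) - 1) := by
      have := Real.rpow_pos_of_pos hz (1 / (2 * θ) - 1)
      positivity
    have := hlmo b hb
    simp only [dot, gvec] at this
    refine le_of_mul_le_mul_left ?_ hκ
    linarith
  · intro s hs
    have := le_of_mul_le_mul_left (hγ s hs) hμ'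
    exact (Real.rpow_le_rpow_iff (hf _) (hf _) (by positivity)).1 this

/-- The trajectory follows `slowOrbit` inside the region where the drift is controlled. -/
lemma exists_orbit (hp : 3 ≤ p) {μ θ : ℝ} (hμ : 0 < μ) (hθ : 0 < θ) :
    ∃ u₁ > (0 : ℝ), ∀ u₀ ∈ Set.Ioc (0 : ℝ) u₁, ∀ x v : ℕ → ℝ × ℝ, ∀ γ : ℕ → ℝ,
      x 0 = xslow p u₀ → IsFWTrajGen p (gvec μ θ) (gobj μ θ) x v γ →
      ∃ r δ u : ℕ → ℝ, IsOrbit p r δ u ∧ ∀ t, fobj (x t) = u t ^ 2 * (1 + slopeSq p (r t)) := by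
  obtain ⟨r₁, hr₁, hreg⟩ := exists_region hp
  obtain ⟨u₁, hu₁, hinit⟩ := exists_initial hp hr₁
  refine ⟨min u₁ (r₁ / 2), by positivity, ?_⟩
  rintro u₀ ⟨hu₀, hu₀'⟩ x v γ hx0 ⟨hlmo, hls, hstep⟩
  set r : ℕ → ℝ := fun t => (slowOrbit p u₀ t).1 with hr
  set δ : ℕ → ℝ := fun t => (slowOrbit p u₀ t).2 with hδ
  have hrs : ∀ t, r (t + 1) = nextR p (r t) (δ t) := fun t => rfl
  have hδs : ∀ t, δ (t + 1) = nextDelta p (r t) (δ t) (slopeSq p (nextR p (r t) (δ t))) :=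
    fun t => rfl
  let u : ℕ → ℝ := fun t =>
    Nat.casesOn t u₀ fun n => slowN p (r n) (δ n) / (1 + slopeSq p (r (n + 1)))
  have hus : ∀ t, u (t + 1) = slowN p (r t) (δ t) / (1 + slopeSq p (r (t + 1))) := fun t => rfl
  have hρ0 : ∀ s, 0 < s → 0 < slopeSq p s := fun s hs => Real.rpow_pos_of_pos hs _
  have hsq : ∀ s, 0 < s → (s ^ alphac p) ^ 2 = slopeSq p s := fun s hs => by
    rw [slopeSq, ← Real.rpow_natCast, ← Real.rpow_mul hs.le, mul_comm]; norm_num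
  have hf : ∀ (w s σ : ℝ), 0 < s → σ ^ 2 = 1 → fobj (1 - w, σ * (s ^ alphac p * w)) =
      w ^ 2 * (1 + slopeSq p s) := by
    intro w s σ hs hσ
    rw [← hsq s hs, fobj]
    linear_combination (s ^ alphac p * w) ^ 2 * hσ
  have main : ∀ t, (0 < r t ∧ r t ≤ r₁ ∧ InRegion p (r t) (δ t) ∧
      slowN p (r t) (δ t) ≤ r₁ / 2 ∧ 0 < u t ∧
      u t * (1 - slopeSq p (r t) * (1 + δ t)) = slowN p (r t) (δ t)) ∧
      ∃ σ : ℝ, σ ^ 2 = 1 ∧ x t = (1 - u t, σ * (r t ^ alphac p * u t)) := by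
    intro t
    induction t with
    | zero =>
      have hs0 : 0 < Cp p + Dp p * u₀ :=
        add_pos (Cp_pos hp) (mul_pos (Dp_pos hp) hu₀)
      have h0 : 0 < r 0 := mul_pos (Real.rpow_pos_of_pos hs0 _) hu₀
      obtain ⟨h1, h2⟩ := hinit u₀ hu₀ (hu₀'.trans (min_le_left _ _))
      have h3 : u 0 * (1 - slopeSq p (r 0) * (1 + δ 0)) = slowN p (r 0) (δ 0) :=
        slowN_lineDelta hu₀ h0
      have h4 : 0 ≤ slopeSq p (r 0) * (1 + δ 0) := by
        have := (abs_le.1 (hreg _ _ h0 h1 h2).2.2.2.1).1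
        exact mul_nonneg (hρ0 _ h0).le (by change -(1 / 2) ≤ δ 0 at this; linarith)
      refine ⟨⟨h0, h1, h2, ?_, hu₀, h3⟩, 1, one_pow 2, ?_⟩
      · rw [← h3]
        have : u 0 * (slopeSq p (r 0) * (1 + δ 0)) ≥ 0 := mul_nonneg hu₀.le h4
        have h5 : u 0 ≤ r₁ / 2 := hu₀'.trans (min_le_right _ _)
        linarith
      · rw [hx0, xslow]
        have hq : qc p * alphac p = 1 := by
          have : p ≠ 0 := by linarith
          have : p - 1 ≠ 0 := by linarith
          unfold qc alphac
          field_simp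
        have : r 0 ^ alphac p = (Cp p + Dp p * u₀) * u₀ ^ alphac p := by
          change (initScale p u₀ * u₀) ^ alphac p = _
          rw [initScale, Real.mul_rpow (Real.rpow_nonneg hs0.le _) hu₀.le,
            ← Real.rpow_mul hs0.le, hq, Real.rpow_one]
        change _ = (1 - u₀, 1 * (r 0 ^ alphac p * u₀))
        rw [this, Real.rpow_add hu₀, Real.rpow_one]
        ring_nf
    | succ t ih =>
      obtain ⟨⟨h0, h1, h2, h3, h4, h5⟩, σ, hσ, hx⟩ := ih
      obtain ⟨g1, g2, g3, g4, g5⟩ := hreg _ _ h0 h1 h2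
      have hδ1 : 0 < 1 + δ t := by linarith [(abs_le.1 g4).1]
      have hN : 0 < slowN p (r t) (δ t) := h0.trans_le g2
      have h0' : 0 < r (t + 1) := mul_pos h0 (Real.rpow_pos_of_pos hδ1 _)
      have h1' : r (t + 1) ≤ r₁ := by rw [hrs]; linarith
      have h2' : InRegion p (r (t + 1)) (δ (t + 1)) := g1
      have hρ' := hρ0 _ h0'
      have hu' : 0 < u (t + 1) := by rw [hus]; positivity
      have h5' : u (t + 1) * (1 - slopeSq p (r (t + 1)) * (1 + δ (t + 1))) =
          slowN p (r (t + 1)) (δ (t + 1)) := by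
        rw [hus]
        refine slowN_nextDelta (ne_of_gt ?_)
        have hP : 0 < (1 + r (t + 1)) ^ (-(1 / p)) := Real.rpow_pos_of_pos (by linarith) _
        have : 0 < slowN p (r t) (δ t) * (slopeSq p (r (t + 1)) / (1 + slopeSq p (r (t + 1)))) := by
          positivity
        exact add_pos (mul_pos h0' hP) this
      refine ⟨⟨h0', h1', h2', ?_, hu', h5'⟩, -σ, by rw [neg_sq, hσ], ?_⟩
      · rw [← h5']
        have hδ2 : -(1 / 2) ≤ δ (t + 1) := (abs_le.1 (hreg _ _ h0' h1' h2').2.2.2.1).1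
        have : 0 ≤ u (t + 1) * (slopeSq p (r (t + 1)) * (1 + δ (t + 1))) :=
          mul_nonneg hu'.le (mul_nonneg hρ'.le (by linarith))
        have : u (t + 1) ≤ slowN p (r t) (δ t) := by
          rw [hus]
          exact div_le_self hN.le (by linarith)
        linarith
      · have hfpos : 0 < fobj (x t) := by
          have := hρ0 _ h0
          rw [hx, hf _ _ _ h0 hσ]; positivity
        obtain ⟨k1, k2⟩ := gvec_gobj_step (p := p) hμ hθ hfpos (hlmo t).2 (hls t).2
        rw [hx] at k1 k2
        rw [hstep, hx]
        refine fw_step hp h0 hδ1 h4 h5 hN hσ (hlmo t).1 ?_ k2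
        intro b hb
        have := k1 b hb
        simpa using this
  refine ⟨r, δ, u, ⟨fun t => (main t).1.1, fun t => ?_, fun t => (main t).1.2.2.1, fun t => ?_,
    fun t => (main t).1.2.2.2.2.1, fun t => (main t).1.2.2.2.2.2, fun t => ?_, hus⟩, fun t => ?_⟩
  · exact (hreg _ _ (main t).1.1 (main t).1.2.1 (main t).1.2.2.1).2.1
  · exact (hreg _ _ (main t).1.1 (main t).1.2.1 (main t).1.2.2.1).2.2.2.1
  · have := (abs_le.1 (hreg _ _ (main t).1.1 (main t).1.2.1 (main t).1.2.2.1).2.2.2.1).1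
    exact slopeSq_nextR hp (main t).1.1 (by linarith)
  · obtain ⟨σ, hσ, hx⟩ := (main t).2
    rw [hx, hf _ _ _ (main t).1.1 hσ]

end Trajectory

section Rate

variable {p : ℝ} {r δ u : ℕ → ℝ}

namespace IsOrbit

lemma slopeSq_pos (h : IsOrbit p r δ u) (t : ℕ) : 0 < slopeSq p (r t) :=
  Real.rpow_pos_of_pos (h.r_pos t) _

lemma slowN_pos (h : IsOrbit p r δ u) (t : ℕ) : 0 < slowN p (r t) (δ t) :=
  (h.r_pos t).trans_le (h.r_le t)

lemma slowN_succ (h : IsOrbit p r δ u) (t : ℕ) : slowN p (r (t + 1)) (δ (t + 1)) =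
    slowN p (r t) (δ t) * ((1 - slopeSq p (r (t + 1)) * (1 + δ (t + 1))) /
      (1 + slopeSq p (r (t + 1)))) := by
  rw [← h.u_mul (t + 1), h.u_succ]; ring

lemma slowN_succ_mul_le (h : IsOrbit p r δ u) (t : ℕ) :
    slowN p (r (t + 1)) (δ (t + 1)) * (1 + slopeSq p (r (t + 1))) ≤ slowN p (r t) (δ t) := by
  have h1 := h.slopeSq_pos (t + 1)
  have h2 := (abs_le.1 (h.abs_le_half (t + 1))).1
  rw [h.slowN_succ, mul_assoc, div_mul_cancel₀ _ (by positivity)]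
  refine mul_le_of_le_one_right (h.slowN_pos t).le ?_
  have : 0 ≤ slopeSq p (r (t + 1)) * (1 + δ (t + 1)) := mul_nonneg h1.le (by linarith)
  linarith

lemma tendsto_r (h : IsOrbit p r δ u) (hp : 3 ≤ p) : Tendsto r atTop (𝓝 0) := by
  have hanti : Antitone fun t => slowN p (r t) (δ t) := by
    refine antitone_nat_of_succ_le fun t => le_trans ?_ (h.slowN_succ_mul_le t)
    exact le_mul_of_one_le_right (h.slowN_pos _).le (by linarith [h.slopeSq_pos (t + 1)])
  obtain ⟨L, hL⟩ : ∃ L, Tendsto (fun t => slowN p (r t) (δ t)) atTop (𝓝 L) :=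
    ⟨_, tendsto_atTop_ciInf hanti ⟨0, by rintro _ ⟨t, rfl⟩; exact (h.slowN_pos t).le⟩⟩
  rcases eq_or_ne L 0 with rfl | hL0
  · exact squeeze_zero (fun t => (h.r_pos t).le) h.r_le hL
  have hL' := (tendsto_add_atTop_iff_nat 1).2 hL
  have h1 : Tendsto (fun t => slowN p (r t) (δ t) / slowN p (r (t + 1)) (δ (t + 1)) - 1)
      atTop (𝓝 0) := by
    simpa [hL0] using (hL.div hL' hL0).sub_const 1
  have h2 : Tendsto (fun t => slopeSq p (r t)) atTop (𝓝 0) := by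
    rw [← tendsto_add_atTop_iff_nat 1]
    refine squeeze_zero (fun t => (h.slopeSq_pos _).le) (fun t => ?_) h1
    rw [le_sub_iff_add_le, le_div_iff₀ (h.slowN_pos _), add_comm, mul_comm]
    exact h.slowN_succ_mul_le t
  have hα : 0 < 2 * alphac p := by
    have : 0 < p - 1 := by linarith
    have : 0 < p := by linarith
    unfold alphac; positivity
  have h3 := h2.rpow_const (p := (2 * alphac p)⁻¹) (Or.inr (by positivity))
  rw [Real.zero_rpow (by positivity)] at h3
  exact h3.congr fun t => Real.rpow_rpow_inv (h.r_pos t).le hα.ne'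

lemma tendsto_slopeSq (h : IsOrbit p r δ u) (hp : 3 ≤ p) :
    Tendsto (fun t => slopeSq p (r t)) atTop (𝓝 0) := by
  have hα : 0 < 2 * alphac p := by
    have : 0 < p - 1 := by linarith
    have : 0 < p := by linarith
    unfold alphac; positivity
  have := (h.tendsto_r hp).rpow_const (p := 2 * alphac p) (Or.inr hα.le)
  rwa [Real.zero_rpow hα.ne'] at this

lemma tendsto_delta (h : IsOrbit p r δ u) (hp : 3 ≤ p) : Tendsto δ atTop (𝓝 0) := by
  have h1 := (h.tendsto_r hp).rpow_const (p := 7 / 6) (Or.inr (by norm_num))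
  rw [Real.zero_rpow (by norm_num)] at h1
  have h2 := squeeze_zero_norm
    (f := fun t => δ t + 2 * alphac p * slopeSq p (r t)) (fun t => h.inRegion t) h1
  simpa using h2.sub ((h.tendsto_slopeSq hp).const_mul (2 * alphac p))

lemma tendsto_slowN_div_r (h : IsOrbit p r δ u) (hp : 3 ≤ p) :
    Tendsto (fun t => slowN p (r t) (δ t) / r t) atTop (𝓝 (1 + 1 / p)) :=
  tendsto_slowN_div (h.tendsto_r hp) (Eventually.of_forall h.r_pos) (h.tendsto_delta hp)

lemma tendsto_slowN_rpow_sub (h : IsOrbit p r δ u) (hp : 3 ≤ p) :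
    Tendsto (fun t => slowN p (r (t + 1)) (δ (t + 1)) ^ (-(2 * alphac p)) -
      slowN p (r t) (δ t) ^ (-(2 * alphac p))) atTop
      (𝓝 (4 * alphac p * (1 + 1 / p) ^ (-(2 * alphac p)))) := by
  set k := 2 * alphac p with hk
  let w : ℕ → ℝ := fun t => (1 - slopeSq p (r (t + 1)) * (1 + δ (t + 1))) /
      (1 + slopeSq p (r (t + 1)))
  have hρ := (tendsto_add_atTop_iff_nat 1).2 (h.tendsto_slopeSq hp)
  have hδ := (tendsto_add_atTop_iff_nat 1).2 (h.tendsto_delta hp)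
  have hw0 : ∀ t, 0 < w t := fun t =>
    pos_of_mul_pos_right (h.slowN_succ t ▸ h.slowN_pos (t + 1)) (h.slowN_pos t).le
  have hw1 : ∀ t, w t - 1 = -slopeSq p (r (t + 1)) * ((2 + δ (t + 1)) /
      (1 + slopeSq p (r (t + 1)))) := by
    intro t
    have := h.slopeSq_pos (t + 1)
    simp only [w]
    field_simp
    ring
  have hw2 : ∀ t, w t - 1 ≠ 0 := by
    intro t
    have h1 := h.slopeSq_pos (t + 1)
    have h2 : 0 < 2 + δ (t + 1) := by linarith [(abs_le.1 (h.abs_le_half (t + 1))).1]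
    rw [hw1]
    exact mul_ne_zero (by linarith) (by positivity)
  have hq : Tendsto (fun t => (2 + δ (t + 1)) / (1 + slopeSq p (r (t + 1)))) atTop (𝓝 2) := by
    have := (hδ.const_add 2).div (hρ.const_add 1) (by norm_num)
    rwa [add_zero, add_zero, div_one] at this
  have hwt : Tendsto (fun t => w t - 1) atTop (𝓝 0) := by
    simp_rw [hw1]
    simpa using hρ.neg.mul hq
  have hd : HasDerivAt (fun x : ℝ => (1 + x) ^ (-k)) (-k) 0 := by
    have := ((hasDerivAt_id (0 : ℝ)).const_add 1).rpow_const (p := -k) (by simp)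
    simpa using this
  have hslope := (hasDerivAt_iff_tendsto_slope_zero.1 hd).comp
    (tendsto_nhdsWithin_iff.2 ⟨hwt, Eventually.of_forall hw2⟩)
  have hratio : Tendsto (fun t => (slowN p (r t) (δ t) / r t) ^ (-k) * (1 + δ t) ^ 2) atTop
      (𝓝 ((1 + 1 / p) ^ (-k) * (1 + 0) ^ 2)) := by
    have : (0 : ℝ) < 1 + 1 / p := by
      have : 0 < p := by linarith
      positivity
    exact ((h.tendsto_slowN_div_r hp).rpow_const (Or.inl this.ne')).mul
      (((h.tendsto_delta hp).const_add 1).pow 2)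
  have := ((hratio.mul hq).neg).mul hslope
  rw [show -((1 + 1 / p) ^ (-k) * (1 + 0) ^ 2 * 2) * -k =
    4 * alphac p * (1 + 1 / p) ^ (-k) by rw [hk]; ring] at this
  refine this.congr fun t => ?_
  have hN := h.slowN_pos t
  have hr := h.r_pos t
  have hrk : slopeSq p (r t) = r t ^ k := rfl
  simp only [Function.comp, zero_add, add_sub_cancel, add_zero, Real.one_rpow, smul_eq_mul]
  rw [h.slowN_succ, Real.mul_rpow hN.le (hw0 t).le, Real.div_rpow hN.le hr.le,
    Real.rpow_neg hr.le, div_inv_eq_mul, ← hrk]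
  have e : slowN p (r t) (δ t) ^ (-k) * slopeSq p (r t) * (1 + δ t) ^ 2 *
      ((2 + δ (t + 1)) / (1 + slopeSq p (r (t + 1)))) =
      -(w t - 1) * slowN p (r t) (δ t) ^ (-k) := by
    rw [hw1, h.slopeSq_succ]; ring
  rw [e]
  have := hw2 t
  field_simp

lemma tendsto_slowN_rpow_div (h : IsOrbit p r δ u) (hp : 3 ≤ p) :
    Tendsto (fun T : ℕ => slowN p (r T) (δ T) ^ (-(2 * alphac p)) / T) atTop
      (𝓝 (4 * alphac p * (1 + 1 / p) ^ (-(2 * alphac p)))) := by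
  have h1 := (h.tendsto_slowN_rpow_sub hp).cesaro
  have h2 := h1.add (tendsto_inv_atTop_nhds_zero_nat (𝕜 := ℝ) |>.mul_const
    (slowN p (r 0) (δ 0) ^ (-(2 * alphac p))))
  rw [zero_mul, add_zero] at h2
  refine h2.congr fun T => ?_
  rw [Finset.sum_range_sub (fun t => slowN p (r t) (δ t) ^ (-(2 * alphac p)))]
  ring

lemma tendsto_u_div (h : IsOrbit p r δ u) (hp : 3 ≤ p) :
    Tendsto (fun t => u t ^ 2 * (1 + slopeSq p (r t)) / slowN p (r t) (δ t) ^ 2)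
      atTop (𝓝 1) := by
  have hρ := h.tendsto_slopeSq hp
  have h1 := (hρ.const_add 1).div
    (((hρ.mul ((h.tendsto_delta hp).const_add 1)).const_sub 1).pow 2) (by norm_num)
  rw [show ((1 : ℝ) + 0) / (1 - 0 * (1 + 0)) ^ 2 = 1 by norm_num] at h1
  refine h1.congr fun t => ?_
  have h2 := h.u_mul t
  have h3 : 0 < 1 - slopeSq p (r t) * (1 + δ t) :=
    pos_of_mul_pos_right (h2 ▸ h.slowN_pos t) (h.u_pos t).le
  have := h.u_pos t
  rw [← h2]
  simp only [Pi.div_apply]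
  field_simp

/-- The rate of any power `f ^ (s / 2)` of the squared distance along the trajectory. -/
lemma tendsto_rpow_mul (h : IsOrbit p r δ u) (hp : 3 ≤ p) (s : ℝ) :
    Tendsto (fun T : ℕ => (u T ^ 2 * (1 + slopeSq p (r T))) ^ (s / 2) *
      (T : ℝ) ^ (s / (2 * alphac p))) atTop
      (𝓝 ((1 + 1 / p) ^ s * (4 * alphac p) ^ (-(s / (2 * alphac p))))) := by
  have hα : 0 < alphac p := by
    have : 0 < p - 1 := by linarith
    have : 0 < p := by linarith
    unfold alphac; positivity
  have ha : (0 : ℝ) < 1 + 1 / p := by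
    have : 0 < p := by linarith
    positivity
  set E := s / (2 * alphac p) with hE
  have h1 := (h.tendsto_slowN_rpow_div hp).rpow_const (p := -E) (Or.inl (by positivity))
  have h2 := ((h.tendsto_u_div hp).rpow_const (p := s / 2) (Or.inl one_ne_zero)).mul h1
  have hkE : -(2 * alphac p) * -E = s := by rw [hE]; field_simp
  rw [Real.one_rpow, one_mul, Real.mul_rpow (by positivity) (by positivity), ← Real.rpow_mul ha.le,
    hkE, mul_comm ((4 * alphac p) ^ (-E))] at h2
  refine h2.congr' ?_
  filter_upwards [eventually_gt_atTop 0] with T hT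
  have hT' : (0 : ℝ) < T := by exact_mod_cast hT
  have hN := h.slowN_pos T
  have hf : 0 ≤ u T ^ 2 * (1 + slopeSq p (r T)) := by
    have := h.slopeSq_pos T
    positivity
  have hNs : (slowN p (r T) (δ T) ^ 2) ^ (s / 2) = slowN p (r T) (δ T) ^ s := by
    rw [← Real.rpow_natCast, ← Real.rpow_mul hN.le]
    congr 1; push_cast; ring
  rw [Real.div_rpow hf (by positivity), hNs, Real.div_rpow (by positivity) hT'.le,
    ← Real.rpow_mul hN.le, hkE, Real.rpow_neg hT'.le, div_inv_eq_mul]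
  have := Real.rpow_pos_of_pos hN s
  field_simp

end IsOrbit

end Rate

section Objective

lemma rpow_sub_rpow_mul_le {x y s : ℝ} (hy : 0 ≤ y) (hyx : y ≤ x) (hs : 0 ≤ s) :
    (x ^ s - y ^ s) * y ≤ s * x ^ s * (x - y) := by
  rcases hy.eq_or_lt with rfl | hy
  · simpa using mul_nonneg (mul_nonneg hs (Real.rpow_nonneg hyx s)) hyx
  have hx : 0 < x := hy.trans_le hyx
  have h1 := one_add_mul_self_le_rpow_one_add (s := y / x - 1) (p := s + 1)
    (by linarith [div_nonneg hy.le hx.le]) (by linarith)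
  rw [add_sub_cancel, Real.div_rpow hy.le hx.le, Real.rpow_add_one hx.ne',
    Real.rpow_add_one hy.ne', le_div_iff₀ (by positivity)] at h1
  have h2 : (1 + (s + 1) * (y / x - 1)) * (x ^ s * x) = x ^ s * x - (s + 1) * x ^ s * (x - y) := by
    field_simp; ring
  rw [h2] at h1
  linarith

lemma fobj_nonneg (z : ℝ × ℝ) : 0 ≤ fobj z := add_nonneg (sq_nonneg _) (sq_nonneg _)

lemma abs_fst_sub_one_le_sqrt_fobj (z : ℝ × ℝ) : |z.1 - 1| ≤ √(fobj z) :=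
  Real.abs_le_sqrt (le_add_of_nonneg_right (sq_nonneg _))

lemma abs_snd_le_sqrt_fobj (z : ℝ × ℝ) : |z.2| ≤ √(fobj z) :=
  Real.abs_le_sqrt (le_add_of_nonneg_left (sq_nonneg _))

lemma sqrt_fobj_le (z w : ℝ × ℝ) : √(fobj z) ≤ √(fobj w) + 2 * dist z w := by
  have h1 : |z.1 - w.1| ≤ dist z w := le_max_left _ _
  have h2 : |z.2 - w.2| ≤ dist z w := le_max_right _ _
  have hD : 0 ≤ dist z w := dist_nonneg
  have key : ∀ a b : ℝ, |a - b| ≤ dist z w → |b| ≤ √(fobj w) →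
      a ^ 2 ≤ b ^ 2 + 2 * √(fobj w) * dist z w + dist z w ^ 2 := by
    intro a b hab hb
    have e1 : (a - b) ^ 2 ≤ dist z w ^ 2 := sq_le_sq' (neg_le_of_abs_le hab) (le_of_abs_le hab)
    have e2 : b * (a - b) ≤ √(fobj w) * dist z w := by
      refine (le_abs_self _).trans ?_
      rw [abs_mul]
      exact mul_le_mul hb hab (abs_nonneg _) (Real.sqrt_nonneg _)
    linarith
  have h3 := key (z.1 - 1) (w.1 - 1) (by simpa using h1) (abs_fst_sub_one_le_sqrt_fobj w)
  have h4 := key z.2 w.2 h2 (abs_snd_le_sqrt_fobj w)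
  rw [Real.sqrt_le_left (by positivity), fobj]
  have h5 := Real.sq_sqrt (fobj_nonneg w)
  have h6 : fobj w = (w.1 - 1) ^ 2 + w.2 ^ 2 := rfl
  nlinarith [Real.sqrt_nonneg (fobj w)]

lemma fobj_le_five {p : ℝ} (hp : 0 < p) {z : ℝ × ℝ} (hz : inBp p z) : fobj z ≤ 5 := by
  have key : ∀ a : ℝ, |a| ^ p ≤ 1 → |a| ≤ 1 := by
    intro a ha
    by_contra! h
    exact absurd ha (not_le.2 (Real.one_lt_rpow h hp))
  have hz' : |z.1| ^ p + |z.2| ^ p ≤ 1 := hz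
  have h1 := key z.1 (by linarith [Real.rpow_nonneg (abs_nonneg z.2) p])
  have h2 := key z.2 (by linarith [Real.rpow_nonneg (abs_nonneg z.1) p])
  rw [abs_le] at h1 h2
  rw [fobj]
  nlinarith

/-- A Lipschitz bound for a coordinate of the radial field `f ^ b • (z - e₁)`. -/
lemma abs_rpow_mul_sub_le {b : ℝ} (hb : 0 ≤ b) {z w : ℝ × ℝ} (hz : fobj z ≤ 5) (hw : fobj w ≤ 5)
    {x y : ℝ} (hx : |x| ≤ √(fobj z)) (hy : |y| ≤ √(fobj w)) (hxy : |x - y| ≤ dist z w) :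
    |fobj z ^ b * x - fobj w ^ b * y| ≤ 5 ^ b * (1 + 4 * b) * dist z w := by
  wlog hwz : fobj w ≤ fobj z generalizing z w x y
  · rw [abs_sub_comm, dist_comm]
    exact this hw hz hy hx (by rwa [abs_sub_comm, dist_comm]) (le_of_not_ge hwz)
  have hpow : ∀ z, fobj z ^ b = √(fobj z) ^ (2 * b) := fun z => by
    rw [Real.sqrt_eq_rpow, ← Real.rpow_mul (fobj_nonneg z)]
    congr 1; ring
  have h5 : fobj z ^ b ≤ 5 ^ b := Real.rpow_le_rpow (fobj_nonneg z) hz hb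
  have hmono : fobj w ^ b ≤ fobj z ^ b := Real.rpow_le_rpow (fobj_nonneg w) hwz hb
  have hD : 0 ≤ dist z w := dist_nonneg
  have h0 : 0 ≤ fobj z ^ b := Real.rpow_nonneg (fobj_nonneg z) b
  have h1 := rpow_sub_rpow_mul_le (s := 2 * b) (Real.sqrt_nonneg _) (Real.sqrt_le_sqrt hwz)
    (by positivity)
  rw [← hpow, ← hpow] at h1
  have h2 := sqrt_fobj_le z w
  calc |fobj z ^ b * x - fobj w ^ b * y|
      = |fobj z ^ b * (x - y) + (fobj z ^ b - fobj w ^ b) * y| := by ring_nf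
    _ ≤ fobj z ^ b * |x - y| + (fobj z ^ b - fobj w ^ b) * |y| := by
        refine (abs_add_le _ _).trans_eq ?_
        rw [abs_mul, abs_mul, abs_of_nonneg h0, abs_of_nonneg (sub_nonneg.2 hmono)]
    _ ≤ fobj z ^ b * dist z w + (fobj z ^ b - fobj w ^ b) * √(fobj w) := by
        gcongr
    _ ≤ fobj z ^ b * dist z w + 2 * b * fobj z ^ b * (2 * dist z w) := by
        refine add_le_add le_rfl (h1.trans ?_)
        gcongr
        linarith
    _ = fobj z ^ b * (1 + 4 * b) * dist z w := by ring
    _ ≤ 5 ^ b * (1 + 4 * b) * dist z w := by gcongr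

lemma exists_lipschitzOnWith_gvec {p μ θ : ℝ} (hp : 0 < p) (hμ : 0 < μ)
    (hθ : θ ∈ Set.Ioc (0 : ℝ) (1 / 2)) :
    ∃ L : NNReal, LipschitzOnWith L (gvec μ θ) {z : ℝ × ℝ | inBp p z} := by
  have hθ0 : 0 < θ := hθ.1
  have hb : 0 ≤ 1 / (2 * θ) - 1 := by
    rw [sub_nonneg, le_div_iff₀ (by positivity)]; linarith [hθ.2]
  have hK : 0 < μ ^ (-(1 / θ)) * (1 / θ) := by
    have := Real.rpow_pos_of_pos hμ (-(1 / θ))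
    positivity
  set b := 1 / (2 * θ) - 1 with hbdef
  set K := μ ^ (-(1 / θ)) * (1 / θ) with hKdef
  have hL : 0 ≤ K * (5 ^ b * (1 + 4 * b)) := by positivity
  refine ⟨⟨_, hL⟩, LipschitzOnWith.of_dist_le_mul fun z hz w hw => ?_⟩
  have hz5 := fobj_le_five hp hz
  have hw5 := fobj_le_five hp hw
  have key : ∀ x y : ℝ, |x| ≤ √(fobj z) → |y| ≤ √(fobj w) → |x - y| ≤ dist z w →
      dist (K * fobj z ^ b * x) (K * fobj w ^ b * y) ≤ K * (5 ^ b * (1 + 4 * b)) * dist z w := by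
    intro x y hx hy hxy
    rw [Real.dist_eq, show K * fobj z ^ b * x - K * fobj w ^ b * y =
      K * (fobj z ^ b * x - fobj w ^ b * y) by ring, abs_mul, abs_of_pos hK, mul_assoc K]
    exact mul_le_mul_of_nonneg_left (abs_rpow_mul_sub_le hb hz5 hw5 hx hy hxy) hK.le
  refine max_le ?_ ?_
  · refine key _ _ (abs_fst_sub_one_le_sqrt_fobj z) (abs_fst_sub_one_le_sqrt_fobj w) ?_
    rw [sub_sub_sub_cancel_right]
    exact le_max_left _ _
  · exact key _ _ (abs_snd_le_sqrt_fobj z) (abs_snd_le_sqrt_fobj w) (le_max_right _ _)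

lemma sqrt_fobj_eq_gobj {μ θ : ℝ} (hμ : 0 < μ) (hθ : 0 < θ) (z : ℝ × ℝ) :
    √(fobj z) = μ * gobj μ θ z ^ θ := by
  have hf := fobj_nonneg z
  rw [gobj, Real.mul_rpow (Real.rpow_nonneg hμ.le _) (Real.rpow_nonneg hf _), ← Real.rpow_mul hμ.le,
    ← Real.rpow_mul hf, show -(1 / θ) * θ = -1 by field_simp,
    show 1 / (2 * θ) * θ = 1 / 2 by field_simp, Real.rpow_neg_one, ← mul_assoc,
    mul_inv_cancel₀ hμ.ne', one_mul, Real.sqrt_eq_rpow]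

end Objective

theorem heb_lower_bound (p : ℝ) (hp : 3 ≤ p) (μ θ : ℝ) (hμ : 0 < μ)
    (hθ : θ ∈ Set.Ioc (0:ℝ) (1/2)) :
    -- g is smooth on B_p: its gradient is Lipschitz there
    (∃ L : NNReal, LipschitzOnWith L (gvec μ θ) {z : ℝ × ℝ | inBp p z}) ∧
    -- g satisfies the (μ,θ)-Hölderian error bound with x* = e₁, g(x*) = 0
    (∀ z : ℝ × ℝ, inBp p z →
      Real.sqrt (fobj z) ≤ μ * (gobj μ θ z) ^ θ) ∧
    -- the lower bound along the slow-start trajectory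
    ∃ u₁ > (0:ℝ), ∀ u₀ ∈ Set.Ioc (0:ℝ) u₁, ∀ x v : ℕ → ℝ × ℝ, ∀ γ : ℕ → ℝ,
      x 0 = xslow p u₀ → IsFWTrajGen p (gvec μ θ) (gobj μ θ) x v γ →
      Filter.Tendsto
        (fun T : ℕ => gobj μ θ (x T) /
          (μ ^ (-(1/θ)) * ((p + 1) / p) ^ (1/θ)
            * (p / (4 * (p - 1))) ^ (p / (2 * θ * (p - 1)))
            * (T : ℝ) ^ (-(p / (2 * θ * (p - 1))))))
        Filter.atTop (nhds 1) ∧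
      ∃ c > (0:ℝ), ∀ T : ℕ,
        c * (T : ℝ) ^ (-(p / (2 * θ * (p - 1)))) ≤ gobj μ θ (x T) := by
  have hp0 : 0 < p := by linarith
  have hp1 : 0 < p - 1 := by linarith
  have hθ0 : 0 < θ := hθ.1
  refine ⟨exists_lipschitzOnWith_gvec hp0 hμ hθ, fun z _ => (sqrt_fobj_eq_gobj hμ hθ0 z).le, ?_⟩
  obtain ⟨u₁, hu₁, horb⟩ := exists_orbit hp hμ hθ0
  refine ⟨u₁, hu₁, fun u₀ hu₀ x v γ hx0 htraj => ?_⟩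
  obtain ⟨r, δ, u, h, hf⟩ := horb u₀ hu₀ x v γ hx0 htraj
  set E := p / (2 * θ * (p - 1)) with hE
  set A := μ ^ (-(1 / θ)) * ((p + 1) / p) ^ (1 / θ) * (p / (4 * (p - 1))) ^ E with hA
  have hμ' : 0 < μ ^ (-(1 / θ)) := Real.rpow_pos_of_pos hμ _
  have hA0 : 0 < A := by positivity
  have hg0 : ∀ T, 0 < gobj μ θ (x T) := by
    intro T
    have h1 := h.slopeSq_pos T
    have h2 := h.u_pos T
    rw [gobj, hf]
    positivity
  have hlim : Tendsto (fun T : ℕ => gobj μ θ (x T) * (T : ℝ) ^ E) atTop (𝓝 A) := by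
    have h1 := (h.tendsto_rpow_mul hp (1 / θ)).const_mul (μ ^ (-(1 / θ)))
    have e1 : 1 / θ / (2 * alphac p) = E := by
      rw [hE, alphac]; field_simp
    have e2 : (4 * alphac p) ^ (-E) = (p / (4 * (p - 1))) ^ E := by
      rw [Real.rpow_neg (by unfold alphac; positivity), ← Real.inv_rpow (by unfold alphac; positivity),
        alphac, mul_div_assoc', inv_div]
    have e3 : 1 + 1 / p = (p + 1) / p := by field_simp
    rw [e1, e2, e3, ← mul_assoc] at h1
    refine h1.congr fun T => ?_
    rw [gobj, hf, div_div, mul_comm θ 2, mul_assoc]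
  have hrpow : ∀ T : ℕ, (T : ℝ) ^ (-E) = ((T : ℝ) ^ E)⁻¹ := fun T =>
    Real.rpow_neg (Nat.cast_nonneg T) E
  constructor
  · have h1 := hlim.div_const A
    rw [div_self hA0.ne'] at h1
    refine h1.congr fun T => ?_
    rw [hrpow, ← div_eq_mul_inv, div_div_eq_mul_div]
  · have h1 := hlim.inv₀ hA0.ne'
    obtain ⟨M, hM⟩ := h1.bddAbove_range
    refine ⟨(max M 1)⁻¹, by positivity, fun T => ?_⟩
    have h2 : (gobj μ θ (x T) * (T : ℝ) ^ E)⁻¹ ≤ max M 1 :=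
      (hM (Set.mem_range_self T)).trans (le_max_left _ _)
    rw [mul_inv, ← hrpow, inv_mul_le_iff₀ (hg0 T)] at h2
    rwa [inv_mul_le_iff₀ (by positivity), mul_comm]

end Stmt15
end
end

section
/- Fix p ≥ 3, q = p/(p-1), α = (p-1)/p, κ = 2 - 2/p, and let I ⊂ (0, p^{1/q}) be compact. With z = y^q, w = y·u^{1+α}, M = (u^q + |w|^q)^{1/q}, v₁ = u^{q-1}/M^{q-1} = (1 + z·u)^{-1/p}, d₁ = v₁ - 1 + u, and d₂ = v₂ - w with |v₂| = (|w|/M)^{q-1}, the exact-line-search step size γ = (M - u + u² + w²)/(d₁² + d₂²) satisfies, uniformly for y ∈ I as u ↓ 0: d₁ = u·(1 - z/p) + O(u²) > 0, d₁² + d₂² = Θ(u^{2/p}), and γ = O(u^κ). In particular γ ≤ 1 for all sufficiently small u > 0, uniformly over y ∈ I. -/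
/-!
STATEMENT 19: Uniform bounds for the exact-line-search step size: with
w = y·u^{1+α}, z = y^q, one has v₁ = (1+z·u)^{-1/p}, |v₂| = (|w|/M)^{q-1},
d₁ = u·(1 - z/p) + O(u²) > 0, d₁² + d₂² = Θ(u^{2/p}), and γ = O(u^κ) with
κ = 2 - 2/p; in particular γ ≤ 1 for all small u > 0, uniformly over y ∈ I.
-/

noncomputable section
open Real

namespace Stmt19

/-- Hölder conjugate q = p/(p-1). -/
def qc (p : ℝ) : ℝ := p / (p - 1)

/-- α = (p-1)/p = 1/q. -/
def alphac (p : ℝ) : ℝ := (p - 1) / p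

/-- M = (u^q + |w|^q)^{1/q}. -/
def Mv (p u w : ℝ) : ℝ := (u ^ qc p + |w| ^ qc p) ^ (1 / qc p)

/-- First coordinate of the LMO output: v₁ = u^{q-1}/M^{q-1}. -/
def v1f (p u w : ℝ) : ℝ := u ^ (qc p - 1) / Mv p u w ^ (qc p - 1)

/-- Second coordinate of the LMO output: v₂ = -sign(w)·|w|^{q-1}/M^{q-1}. -/
def v2f (p u w : ℝ) : ℝ := -(Real.sign w) * |w| ^ (qc p - 1) / Mv p u w ^ (qc p - 1)

/-- d₁ = v₁ - 1 + u. -/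
def d1f (p u w : ℝ) : ℝ := v1f p u w - 1 + u

/-- d₂ = v₂ - w. -/
def d2f (p u w : ℝ) : ℝ := v2f p u w - w

/-- Exact line-search step size γ = (M - u + u² + w²)/(d₁² + d₂²). -/
def gamf (p u w : ℝ) : ℝ :=
  (Mv p u w - u + u ^ 2 + w ^ 2) / (d1f p u w ^ 2 + d2f p u w ^ 2)

/-- u' = u - γ·d₁. -/
def uN (p u w : ℝ) : ℝ := u - gamf p u w * d1f p u w

/-- w' = w + γ·d₂. -/
def wN (p u w : ℝ) : ℝ := w + gamf p u w * d2f p u w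

/-- Scaled one-step map Φ(u,y) = |w'|/(u')^{1+α} where w = y·u^{1+α}. -/
def Phi (p u y : ℝ) : ℝ :=
  |wN p u (y * u ^ (1 + alphac p))| /
    (uN p u (y * u ^ (1 + alphac p))) ^ (1 + alphac p)

/-- C_p = (p/(p+1))^{1/q}. -/
def Cp (p : ℝ) : ℝ := (p / (p + 1)) ^ (1 / qc p)

/-- D_p = C_p·(p-1)(3p+1)/(2p(p+1)²). -/
def Dp (p : ℝ) : ℝ := Cp p * ((p - 1) * (3 * p + 1)) / (2 * p * (p + 1) ^ 2)

/-- With `w = y·u^{1+α}`, the dual norm is `M = u·(1 + z·u)^{1/q}`. -/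
lemma Mv_scaled {p u y : ℝ} (hp : 1 < p) (hu : 0 < u) (hy : 0 < y) :
    Mv p u (y * u ^ (1 + alphac p)) = u * (1 + y ^ qc p * u) ^ (1 / qc p) := by
  have hp' : 0 < p - 1 := by linarith
  have hq : qc p ≠ 0 := by unfold qc; positivity
  have hexp : (1 + alphac p) * qc p = qc p + 1 := by
    unfold qc alphac; field_simp
  have hw : 0 < y * u ^ (1 + alphac p) := by positivity
  have hsum : u ^ qc p + |y * u ^ (1 + alphac p)| ^ qc p
      = u ^ qc p * (1 + y ^ qc p * u) := by
    rw [abs_of_pos hw, mul_rpow hy.le (by positivity), ← rpow_mul hu.le, hexp,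
      rpow_add hu, rpow_one]
    ring
  rw [Mv, hsum, mul_rpow (by positivity) (by positivity), one_div, rpow_rpow_inv hu.le hq]

lemma Mv_scaled_rpow {p u y : ℝ} (hp : 1 < p) (hu : 0 < u) (hy : 0 < y) :
    Mv p u (y * u ^ (1 + alphac p)) ^ (qc p - 1)
      = u ^ (qc p - 1) * (1 + y ^ qc p * u) ^ (1 / p) := by
  have hp' : 0 < p - 1 := by linarith
  have hexp : 1 / qc p * (qc p - 1) = 1 / p := by
    unfold qc; field_simp; ring
  rw [Mv_scaled hp hu hy, mul_rpow hu.le (by positivity), ← rpow_mul (by positivity), hexp]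

lemma v1f_scaled {p u y : ℝ} (hp : 1 < p) (hu : 0 < u) (hy : 0 < y) :
    v1f p u (y * u ^ (1 + alphac p)) = (1 + y ^ qc p * u) ^ (-(1 / p)) := by
  rw [v1f, Mv_scaled_rpow hp hu hy, rpow_neg (by positivity)]
  have : u ^ (qc p - 1) ≠ 0 := by positivity
  field_simp

lemma v2f_scaled {p u y : ℝ} (hp : 1 < p) (hu : 0 < u) (hy : 0 < y) :
    v2f p u (y * u ^ (1 + alphac p))
      = -(y ^ (qc p - 1) * u ^ (1 / p) * (1 + y ^ qc p * u) ^ (-(1 / p))) := by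
  have hp' : 0 < p - 1 := by linarith
  have hw : 0 < y * u ^ (1 + alphac p) := by positivity
  have hexp : (1 + alphac p) * (qc p - 1) = (qc p - 1) + 1 / p := by
    unfold qc alphac; field_simp; ring
  rw [v2f, Mv_scaled_rpow hp hu hy, rpow_neg (by positivity), abs_of_pos hw,
    Real.sign_of_pos hw, mul_rpow hy.le (by positivity), ← rpow_mul hu.le, hexp, rpow_add hu]
  have : u ^ (qc p - 1) ≠ 0 := by positivity
  field_simp

lemma abs_v2f {p u w : ℝ} (hu : 0 < u) (hw : 0 < w) :
    |v2f p u w| = (|w| / Mv p u w) ^ (qc p - 1) := by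
  have hM : 0 ≤ Mv p u w := by unfold Mv; positivity
  rw [v2f, Real.sign_of_pos hw, div_rpow (abs_nonneg _) hM, abs_div, abs_mul,
    abs_of_nonneg (rpow_nonneg hM _), abs_of_nonneg (rpow_nonneg (abs_nonneg w) _)]
  simp

lemma one_sub_mul_le_one_add_rpow_neg {s t : ℝ} (hs : 0 ≤ s) (hs1 : s ≤ 1) (ht : 0 ≤ t) :
    1 - s * t ≤ (1 + t) ^ (-s) := by
  have h := rpow_one_add_le_one_add_mul_self (s := t) (by linarith) hs hs1
  have hpos : 0 < (1 + t) ^ s := by positivity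
  rw [rpow_neg (by positivity), ← one_div, le_div_iff₀ hpos]
  have hst : 0 ≤ s * t := by positivity
  have hone : 1 ≤ (1 + t) ^ s := one_le_rpow (by linarith) hs
  nlinarith [sq_nonneg (s * t)]

lemma one_add_rpow_neg_le {s t : ℝ} (hs : 0 ≤ s) (hs1 : s ≤ 1) (ht : 0 ≤ t) :
    (1 + t) ^ (-s) ≤ 1 - s * t + s * t ^ 2 := by
  have hd : 0 < 1 + t := by linarith
  have hr : t / (1 + t) ≤ 1 := by rw [div_le_one hd]; linarith
  have h := rpow_one_add_le_one_add_mul_self (s := -(t / (1 + t))) (by linarith) hs hs1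
  have hbase : 1 + -(t / (1 + t)) = (1 + t)⁻¹ := by field_simp; ring
  rw [hbase, inv_rpow hd.le, ← rpow_neg hd.le] at h
  have hfrac : t - t ^ 2 ≤ t / (1 + t) := by
    rw [le_div_iff₀ hd]
    nlinarith [pow_nonneg ht 3]
  nlinarith [mul_le_mul_of_nonneg_left hfrac hs]

theorem step_size_bounds (p : ℝ) (hp : 3 ≤ p) (I : Set ℝ) (hIc : IsCompact I)
    (hIsub : I ⊆ Set.Ioo 0 (p ^ (1 / qc p))) :
    ∃ C > (0:ℝ), ∃ c₁ > (0:ℝ), ∃ c₂ > (0:ℝ), ∃ u₀ > (0:ℝ),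
      ∀ u ∈ Set.Ioc (0:ℝ) u₀, ∀ y ∈ I,
      -- v₁ = (1 + z·u)^{-1/p}
      v1f p u (y * u ^ (1 + alphac p)) = (1 + y ^ qc p * u) ^ (-(1 / p)) ∧
      -- |v₂| = (|w|/M)^{q-1}
      |v2f p u (y * u ^ (1 + alphac p))|
        = (|y * u ^ (1 + alphac p)| / Mv p u (y * u ^ (1 + alphac p))) ^ (qc p - 1) ∧
      -- d₁ = u·(1 - z/p) + O(u²), and d₁ > 0
      |d1f p u (y * u ^ (1 + alphac p)) - u * (1 - y ^ qc p / p)| ≤ C * u ^ 2 ∧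
      0 < d1f p u (y * u ^ (1 + alphac p)) ∧
      -- d₁² + d₂² = Θ(u^{2/p})
      c₁ * u ^ ((2:ℝ) / p)
        ≤ d1f p u (y * u ^ (1 + alphac p)) ^ 2 + d2f p u (y * u ^ (1 + alphac p)) ^ 2 ∧
      d1f p u (y * u ^ (1 + alphac p)) ^ 2 + d2f p u (y * u ^ (1 + alphac p)) ^ 2
        ≤ c₂ * u ^ ((2:ℝ) / p) ∧
      -- γ = O(u^κ) with κ = 2 - 2/p, and γ ≤ 1
      |gamf p u (y * u ^ (1 + alphac p))| ≤ C * u ^ (2 - 2 / p) ∧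
      gamf p u (y * u ^ (1 + alphac p)) ≤ 1 := by
  have hp0 : 0 < p := by linarith
  have hp1 : 1 < p := by linarith
  have hpm : 0 < p - 1 := by linarith
  have hq : 1 < qc p := by unfold qc; rw [lt_div_iff₀ hpm]; linarith
  have hq2 : qc p - 1 ≤ 1 := by
    unfold qc; rw [sub_le_iff_le_add, div_le_iff₀ hpm]; linarith
  have hq0 : 0 < qc p := by linarith
  have hs0 : 0 ≤ 1 / p := by positivity
  have hs1 : 1 / p ≤ 1 := by rw [div_le_one hp0]; linarith
  have hα : 0 ≤ alphac p := by unfold alphac; positivity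
  obtain ⟨a, ha, hIa⟩ : ∃ a > 0, ∀ y ∈ I, a ≤ y := by
    rcases I.eq_empty_or_nonempty with rfl | hne
    · exact ⟨1, one_pos, by simp⟩
    · obtain ⟨a, haI, hmin⟩ := hIc.exists_isLeast hne
      exact ⟨a, (hIsub haI).1, fun y hy => hmin hy⟩
  set b : ℝ := a ^ (qc p - 1) * (1 + p) ^ (-(1 / p)) with hb
  have hb0 : 0 < b := by positivity
  set K : ℝ := (p + 1 + p ^ 2) / b ^ 2 with hK
  have hK0 : 0 < K := by positivity
  refine ⟨p + K, by positivity, b ^ 2, by positivity, 1 + (2 * p) ^ 2, by positivity,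
    min 1 (1 / K), by positivity, ?_⟩
  rintro u ⟨hu, hule⟩ y hyI
  have hu1 : u ≤ 1 := hule.trans (min_le_left _ _)
  have huK : u ≤ 1 / K := hule.trans (min_le_right _ _)
  obtain ⟨hy, hylt⟩ := hIsub hyI
  have hay := hIa y hyI
  have hyp : y ≤ p := by
    refine hylt.le.trans ((rpow_le_rpow_of_exponent_le hp1.le ?_).trans_eq (rpow_one p))
    rw [div_le_one hq0]; exact hq.le
  have hzp : y ^ qc p < p := by
    have := rpow_lt_rpow hy.le hylt hq0
    rwa [one_div, rpow_inv_rpow hp0.le hq0.ne'] at this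
  have hv1 := v1f_scaled hp1 hu hy
  have hv2 := v2f_scaled hp1 hu hy
  have hM := Mv_scaled hp1 hu hy
  have hw : 0 < y * u ^ (1 + alphac p) := by positivity
  have habs := abs_v2f (p := p) hu hw
  have hwu : y * u ^ (1 + alphac p) ≤ p * u := by
    have : u ^ (1 + alphac p) ≤ u := by
      simpa using rpow_le_rpow_of_exponent_ge hu hu1 (show 1 ≤ 1 + alphac p by linarith)
    gcongr
  have hus : u ≤ u ^ (1 / p) := by
    simpa using rpow_le_rpow_of_exponent_ge hu hu1 hs1
  have hus2 : (u ^ (1 / p)) ^ 2 = u ^ (2 / p) := by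
    rw [← rpow_natCast, ← rpow_mul hu.le]; congr 1; push_cast; ring
  have hz0 : 0 < y ^ qc p := by positivity
  have hyq : a ^ (qc p - 1) ≤ y ^ (qc p - 1) := rpow_le_rpow ha.le hay (by linarith)
  have hyq' : y ^ (qc p - 1) ≤ p :=
    (rpow_le_rpow hy.le hyp (by linarith)).trans
      ((rpow_le_rpow_of_exponent_le hp1.le hq2).trans_eq (rpow_one p))
  set w := y * u ^ (1 + alphac p) with hw_def
  set z := y ^ qc p with hz_def
  have ht0 : 0 ≤ z * u := by positivity
  have ht1 : z * u ≤ p := by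
    simpa using mul_le_mul hzp.le hu1 hu.le hp0.le
  have hlow := one_sub_mul_le_one_add_rpow_neg hs0 hs1 ht0
  have hupp := one_add_rpow_neg_le hs0 hs1 ht0
  have hv1le : (1 + z * u) ^ (-(1 / p)) ≤ 1 :=
    rpow_le_one_of_one_le_of_nonpos (by linarith) (by linarith)
  have hv1ge : (1 + p) ^ (-(1 / p)) ≤ (1 + z * u) ^ (-(1 / p)) :=
    rpow_le_rpow_of_nonpos (by linarith) (by linarith) (by linarith)
  have hd1 : d1f p u w = (1 + z * u) ^ (-(1 / p)) - 1 + u := by rw [d1f, hv1]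
  have hlin : u * (1 - z / p) = u - 1 / p * (z * u) := by ring
  have hquad : 1 / p * (z * u) ^ 2 ≤ p * u ^ 2 := by
    have : z ^ 2 ≤ p ^ 2 := by gcongr
    calc 1 / p * (z * u) ^ 2 = 1 / p * z ^ 2 * u ^ 2 := by ring
      _ ≤ 1 / p * p ^ 2 * u ^ 2 := by gcongr
      _ = p * u ^ 2 := by field_simp
  have hd1pos : 0 < d1f p u w := by
    have : 0 < u * (1 - z / p) := mul_pos hu (by rw [sub_pos, div_lt_one hp0]; exact hzp)
    linarith
  have hd1le : d1f p u w ≤ u ^ (1 / p) := by linarith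
  have hd2 : d2f p u w =
      -(y ^ (qc p - 1) * u ^ (1 / p) * (1 + z * u) ^ (-(1 / p)) + w) := by
    rw [d2f, hv2]; ring
  have hd2low : b * u ^ (1 / p) ≤ -d2f p u w := by
    have : b * u ^ (1 / p) ≤ y ^ (qc p - 1) * u ^ (1 / p) * (1 + z * u) ^ (-(1 / p)) := by
      calc b * u ^ (1 / p) = a ^ (qc p - 1) * u ^ (1 / p) * (1 + p) ^ (-(1 / p)) := by
            rw [hb]; ring
        _ ≤ _ := by gcongr
    linarith
  have hd2upp : -d2f p u w ≤ 2 * p * u ^ (1 / p) := by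
    have h1 : y ^ (qc p - 1) * u ^ (1 / p) * (1 + z * u) ^ (-(1 / p))
        ≤ p * u ^ (1 / p) * 1 := by gcongr
    have h2 : p * u ≤ p * u ^ (1 / p) := by gcongr
    linarith
  have hDlow : b ^ 2 * u ^ (2 / p) ≤ d1f p u w ^ 2 + d2f p u w ^ 2 := by
    have := pow_le_pow_left₀ (by positivity) hd2low 2
    rw [mul_pow, hus2, neg_sq] at this
    linarith [sq_nonneg (d1f p u w)]
  have hDupp : d1f p u w ^ 2 + d2f p u w ^ 2 ≤ (1 + (2 * p) ^ 2) * u ^ (2 / p) := by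
    have h1 := pow_le_pow_left₀ hd1pos.le hd1le 2
    have h2 := pow_le_pow_left₀ (le_trans (by positivity) hd2low) hd2upp 2
    rw [mul_pow, hus2, neg_sq] at h2
    rw [hus2] at h1
    linarith
  have hMlow : u ≤ Mv p u w := by
    rw [hM]
    exact le_mul_of_one_le_right hu.le (one_le_rpow (by linarith) (by positivity))
  have hMupp : Mv p u w ≤ u + p * u ^ 2 := by
    have hq1 : 1 / qc p ≤ 1 := by rw [div_le_one hq0]; exact hq.le
    have h1 : (1 + z * u) ^ (1 / qc p) ≤ 1 + z * u :=
      (rpow_le_rpow_of_exponent_le (by linarith) hq1).trans_eq (rpow_one _)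
    calc Mv p u w ≤ u * (1 + z * u) := by rw [hM]; gcongr
      _ = u + z * u ^ 2 := by ring
      _ ≤ u + p * u ^ 2 := by gcongr
  have hnum : Mv p u w - u + u ^ 2 + w ^ 2 ≤ (p + 1 + p ^ 2) * u ^ 2 := by
    have := pow_le_pow_left₀ hw.le hwu 2
    rw [mul_pow] at this
    linarith
  have hnum0 : 0 ≤ Mv p u w - u + u ^ 2 + w ^ 2 := by
    have := sq_nonneg u
    have := sq_nonneg w
    linarith
  have hγ0 : 0 ≤ gamf p u w := div_nonneg hnum0 (by positivity)
  have hγ : gamf p u w ≤ K * u ^ (2 - 2 / p) := by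
    calc gamf p u w ≤ (p + 1 + p ^ 2) * u ^ 2 / (b ^ 2 * u ^ (2 / p)) := by
          unfold gamf; gcongr
      _ = K * u ^ (2 - 2 / p) := by
          rw [rpow_sub hu, rpow_two, hK]; field_simp
  refine ⟨hv1, habs, ?_, hd1pos, hDlow, hDupp, ?_, ?_⟩
  · have : 0 ≤ K * u ^ 2 := by positivity
    rw [abs_of_nonneg (by linarith), add_mul]
    linarith
  · rw [abs_of_nonneg hγ0]
    exact hγ.trans (by gcongr; linarith)
  · have hκ : 1 ≤ 2 - 2 / p := by
      have : 2 / p ≤ 1 := by rw [div_le_one hp0]; linarith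
      linarith
    have huκ : u ^ (2 - 2 / p) ≤ u := by
      simpa using rpow_le_rpow_of_exponent_ge hu hu1 hκ
    calc gamf p u w ≤ K * u := hγ.trans (by gcongr)
      _ ≤ K * (1 / K) := by gcongr
      _ = 1 := by field_simp

end Stmt19
end
end
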